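/- arXiv:1802.02111 — 6 statements merged into one kernel-verified Lean document; each statement's English description precedes it below -/
import Mathlib

section
/- Let F be a field and let A be a finite subset of F with |A| ≥ 2. Then there exists a finite subset A' of F such that A' = −A', {0, 1} ⊆ A', |A'| ≥ |A|, and for every n ≥ 1 one has |D_{2n}(A)| ≥ |D_n(A')|. -/
open scoped Pointwise

/-- `detSet n A` is the set of all determinants of `n × n` matrices with entries in `A`. -/
def detSet {F : Type*} [Field F] (n : ℕ) (A : Finset F) : Set F :=
  {d | ∃ M : Matrix (Fin n) (Fin n) F, (∀ i j, M i j ∈ A) ∧ M.det = d}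

theorem finite_detSet {F : Type*} [Field F] (n : ℕ) (A : Finset F) : (detSet n A).Finite := by
  have h : {M : Matrix (Fin n) (Fin n) F | ∀ i j, M i j ∈ A}.Finite := by
    have := Set.Finite.pi' fun _ : Fin n => Set.Finite.pi' fun _ : Fin n => A.finite_toSet
    exact this
  exact h.image Matrix.det

/-- The determinant of the matrix with `a` on and below the diagonal and `b` above it. -/
theorem det_ite_le {R : Type*} [CommRing R] (n : ℕ) (a b : R) :
    (Matrix.of fun i j : Fin (n + 1) => if j ≤ i then a else b).det = a * (a - b) ^ n := by
  rw [Matrix.det_eq_of_forall_row_eq_smul_add_pred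
    (B := Matrix.of (Fin.cons (fun j => if j = 0 then a else b)
      fun i j => if j = i.succ then a - b else 0)) (fun _ => 1)]
  · rw [Matrix.det_of_isUpperTriangular]
    · simp [Fin.prod_univ_succ]
    · intro i j hij
      induction i using Fin.cases with
      | zero => exact absurd hij (Fin.not_lt_zero _)
      | succ i => simp [(show j < i.succ from hij).ne]
  · intro j
    simp
  · intro i j
    simp only [Matrix.of_apply, Fin.cons_succ, one_mul, Fin.le_def, Fin.ext_iff, Fin.val_succ,
      Fin.val_castSucc]
    split_ifs <;> first | omega | simp

theorem exists_det_ne_zero {F : Type*} [Field F] {A : Finset F} (hA : 2 ≤ A.card) (n : ℕ) :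
    ∃ T : Matrix (Fin n) (Fin n) F, (∀ i j, T i j ∈ A) ∧ T.det ≠ 0 := by
  cases n with
  | zero => exact ⟨0, fun i => i.elim0, by simp⟩
  | succ n =>
    obtain ⟨a, ha, ha0⟩ := Finset.exists_mem_ne (by omega : 1 < A.card) 0
    obtain ⟨b, hb, hba⟩ := Finset.exists_mem_ne (by omega : 1 < A.card) a
    refine ⟨Matrix.of fun i j => if j ≤ i then a else b, fun i j => ?_, ?_⟩
    · simp only [Matrix.of_apply]
      split_ifs <;> assumption
    · rw [det_ite_le]
      exact mul_ne_zero ha0 (pow_ne_zero _ (sub_ne_zero.2 hba.symm))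

theorem det_fromBlocks_self_top {R n : Type*} [CommRing R] [Fintype n] [DecidableEq n]
    (T X Y : Matrix n n R) : (Matrix.fromBlocks T T X Y).det = T.det * (Y - X).det := by
  have h : Matrix.fromBlocks T T X Y =
      Matrix.fromBlocks T 0 X (Y - X) * Matrix.fromBlocks 1 1 0 1 := by
    simp [Matrix.fromBlocks_multiply]
  rw [h, Matrix.det_mul, Matrix.det_fromBlocks_zero₁₂, Matrix.det_fromBlocks_zero₂₁]
  simp

/-- For a finite set `A` with `|A| ≥ 2` in a field `F`, there is a finite set `A'` with
`A' = -A'`, `{0, 1} ⊆ A'`, `|A'| ≥ |A|`, and `|D_{2n}(A)| ≥ |D_n(A')|` for every `n ≥ 1`. -/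
theorem exists_symmetric_set_detSet_card_le {F : Type*} [Field F] [DecidableEq F]
    (A : Finset F) (hA : 2 ≤ A.card) :
    ∃ A' : Finset F, A' = -A' ∧ (0 : F) ∈ A' ∧ (1 : F) ∈ A' ∧ A.card ≤ A'.card ∧
      ∀ n : ℕ, 1 ≤ n → (detSet n A').ncard ≤ (detSet (2 * n) A).ncard := by
  obtain ⟨a, ha, b, hb, hab⟩ := Finset.one_lt_card.1 (by omega : 1 < A.card)
  have hd : a - b ≠ 0 := sub_ne_zero.2 hab
  have hmem : ∀ x, x ∈ (A - A).image (· / (a - b)) ↔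
      ∃ y ∈ A, ∃ z ∈ A, (y - z) / (a - b) = x := by
    simp [Finset.mem_sub]
  refine ⟨(A - A).image (· / (a - b)), ?_, ?_, ?_, ?_, fun n _ => ?_⟩
  · ext x
    rw [Finset.mem_neg', hmem, hmem]
    constructor <;> rintro ⟨y, hy, z, hz, h⟩ <;> refine ⟨z, hz, y, hy, ?_⟩
    · rw [← h]; ring
    · rw [← neg_eq_iff_eq_neg.2 h]; ring
  · exact (hmem _).2 ⟨a, ha, a, ha, by simp⟩
  · exact (hmem _).2 ⟨a, ha, b, hb, div_self hd⟩
  · rw [Finset.card_image_of_injective _ fun x y => (div_left_inj' hd).1]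
    exact Finset.card_le_card_sub_right ⟨a, ha⟩
  · obtain ⟨T, hT, hT0⟩ := exists_det_ne_zero hA n
    refine Set.ncard_le_ncard_of_injOn (fun x => T.det * ((a - b) ^ n * x)) ?_ ?_
      (finite_detSet _ _)
    · rintro _ ⟨M, hM, rfl⟩
      simp only [hmem] at hM
      choose Y hY X hX hYX using hM
      have hsub : Matrix.of Y - Matrix.of X = (a - b) • M := by
        ext i j
        simp [← hYX, mul_div_cancel₀ _ hd]
      let e : Fin (2 * n) ≃ Fin n ⊕ Fin n := (finCongr (two_mul n)).trans finSumFinEquiv.symm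
      refine ⟨(Matrix.fromBlocks T T (Matrix.of X) (Matrix.of Y)).submatrix e e, fun i j => ?_, ?_⟩
      · rw [Matrix.submatrix_apply]
        rcases e i with i | i <;> rcases e j with j | j
        exacts [hT i j, hT i j, hX i j, hY i j]
      · rw [Matrix.det_submatrix_equiv_self, det_fromBlocks_self_top, hsub, Matrix.det_smul,
          Fintype.card_fin]
    · exact ((mul_right_injective₀ hT0).comp
        (mul_right_injective₀ (pow_ne_zero n hd))).injOn
end

section
/- Let F be a field, m ≥ 1, n ≥ 2, and let a_{i,j} ∈ F for 1 ≤ i ≤ m, 1 ≤ j ≤ n. Let 𝓜(a) be the (m(n−1)+1) × (m(n−1)+1) matrix defined as follows: index rows and columns by 0 and by pairs corresponding to the i-th block of size (n−1). The first row of 𝓜(a) has the entry a_{i,n} in the first column of the i-th block and zeros elsewhere; for each i, the first column of 𝓜(a) has the entry a_{i,1} in the last row of the i-th block; the i-th diagonal block is the (n−1) × (n−1) upper bidiagonal matrix M(a_i) with all diagonal entries 1 and superdiagonal entries a_{i,n−1}, a_{i,n−2}, …, a_{i,2}; all other entries are 0. Then det(𝓜(a)) = (−1)^{n+1} · Σ_{i=1}^{m}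 Π_{j=1}^{n} a_{i,j}. -/
/-- The `(m(n-1)+1) × (m(n-1)+1)` matrix `𝓜(a)` from the construction: row and column `0`
are the "first" row and column; the remaining indices split into `m` blocks of size `n-1`,
the index `1 + i(n-1) + r` corresponding to position `r` of block `i`.  The first row has
entry `a_{i,n}` (here `a i ⟨n-1⟩`, as `a i ⟨j-1⟩` encodes `a_{i,j}`) in the first column of
block `i`; the first column has entry `a_{i,1}` (here `a i 0`) in the last row of block `i`;
the `i`-th diagonal block has `1` on its diagonal and superdiagonal entries
`a_{i,n-1}, a_{i,n-2}, …, a_{i,2}`; all other entries vanish. -/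
def calM {F : Type*} [Field F] (m n : ℕ) (a : Fin m → Fin n → F) :
    Matrix (Fin (m * (n - 1) + 1)) (Fin (m * (n - 1) + 1)) F :=
  Matrix.of fun p q =>
    let P : ℕ := (p : ℕ)
    let Q : ℕ := (q : ℕ)
    if P = 0 then
      if Q = 0 then 0
      else if (Q - 1) % (n - 1) = 0 then
        if h : (Q - 1) / (n - 1) < m ∧ n - 1 < n then
          a ⟨(Q - 1) / (n - 1), h.1⟩ ⟨n - 1, h.2⟩
        else 0
      else 0
    else if Q = 0 then
      if (P - 1) % (n - 1) = n - 2 then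
        if h : (P - 1) / (n - 1) < m ∧ 0 < n then
          a ⟨(P - 1) / (n - 1), h.1⟩ ⟨0, h.2⟩
        else 0
      else 0
    else
      if (P - 1) / (n - 1) = (Q - 1) / (n - 1) then
        if (P - 1) % (n - 1) = (Q - 1) % (n - 1) then 1
        else if (Q - 1) % (n - 1) = (P - 1) % (n - 1) + 1 then
          if h : (P - 1) / (n - 1) < m ∧ n - 2 - (P - 1) % (n - 1) < n then
            a ⟨(P - 1) / (n - 1), h.1⟩ ⟨n - 2 - (P - 1) % (n - 1), h.2⟩
          else 0
        else 0
      else 0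

namespace calM

variable {F : Type*} [Field F] {m k : ℕ}

/-- The row or column index of `calM m (k + 2) a` at position `r` of block `i`. -/
def blockIndex (p : Fin m × Fin (k + 1)) : Fin (m * (k + 1) + 1) :=
  (finProdFinEquiv p).succ

theorem val_blockIndex_sub_one (p : Fin m × Fin (k + 1)) :
    (blockIndex p : ℕ) - 1 = p.2 + (k + 1) * p.1 := by
  simp [blockIndex, finProdFinEquiv]

theorem val_blockIndex_ne_zero (p : Fin m × Fin (k + 1)) : (blockIndex p : ℕ) ≠ 0 :=
  Nat.succ_ne_zero _

theorem blockIndex_ne_zero (p : Fin m × Fin (k + 1)) : blockIndex p ≠ 0 :=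
  Fin.succ_ne_zero _

theorem val_blockIndex_div (p : Fin m × Fin (k + 1)) :
    ((blockIndex p : ℕ) - 1) / (k + 1) = p.1 := by
  rw [val_blockIndex_sub_one, Nat.add_mul_div_left _ _ k.succ_pos, Nat.div_eq_of_lt p.2.2,
    zero_add]

theorem val_blockIndex_mod (p : Fin m × Fin (k + 1)) :
    ((blockIndex p : ℕ) - 1) % (k + 1) = p.2 := by
  rw [val_blockIndex_sub_one, Nat.add_mul_mod_self_left, Nat.mod_eq_of_lt p.2.2]

/-- The matrix `calM m (k + 2) a`, with its index type written without subtraction. -/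
def succMatrix (a : Fin m → Fin (k + 2) → F) :
    Matrix (Fin (m * (k + 1) + 1)) (Fin (m * (k + 1) + 1)) F :=
  calM m (k + 2) a

theorem zero_zero (a : Fin m → Fin (k + 2) → F) : succMatrix a 0 0 = 0 := by
  simp [succMatrix, calM]

theorem zero_blockIndex (a : Fin m → Fin (k + 2) → F) (p : Fin m × Fin (k + 1)) :
    succMatrix a 0 (blockIndex p) = if p.2 = 0 then a p.1 (Fin.last _) else 0 := by
  simp [succMatrix, calM, val_blockIndex_div, val_blockIndex_mod, blockIndex_ne_zero, Fin.last]

theorem blockIndex_zero (a : Fin m → Fin (k + 2) → F) (p : Fin m × Fin (k + 1)) :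
    succMatrix a (blockIndex p) 0 = if (p.2 : ℕ) = k then a p.1 0 else 0 := by
  simp [succMatrix, calM, val_blockIndex_div, val_blockIndex_mod, blockIndex_ne_zero]

theorem blockIndex_blockIndex (a : Fin m → Fin (k + 2) → F) (p q : Fin m × Fin (k + 1)) :
    succMatrix a (blockIndex p) (blockIndex q) =
      if p.1 = q.1 then if p.2 = q.2 then 1 else
        if (q.2 : ℕ) = p.2 + 1 then a p.1 ⟨k - p.2, by omega⟩ else 0 else 0 := by
  have h : k - (p.2 : ℕ) < k + 2 := by omega
  simp [succMatrix, calM, val_blockIndex_div, val_blockIndex_mod, blockIndex_ne_zero,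
    Fin.val_inj, h]

theorem sum_eq {M : Type*} [AddCommMonoid M] (f : Fin (m * (k + 1) + 1) → M) :
    ∑ q, f q = f 0 + ∑ i, ∑ r, f (blockIndex (i, r)) := by
  rw [Fin.sum_univ_succ, ← finProdFinEquiv.sum_comp, Fintype.sum_prod_type]
  rfl

theorem eq_zero_or_eq_blockIndex (q : Fin (m * (k + 1) + 1)) :
    q = 0 ∨ ∃ p, q = blockIndex p := by
  refine Fin.cases (Or.inl rfl) (fun q => Or.inr ⟨finProdFinEquiv.symm q, ?_⟩) q
  rw [blockIndex, Equiv.apply_symm_apply]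

/-- The product of the first `l` entries of the `i`-th row of `a`. -/
def prefixProd (a : Fin m → Fin (k + 2) → F) (i : Fin m) (l : ℕ) : F :=
  ∏ j ∈ Finset.range l, if h : j < k + 2 then a i ⟨j, h⟩ else 1

theorem prefixProd_succ (a : Fin m → Fin (k + 2) → F) (i : Fin m) {l : ℕ} (h : l < k + 2) :
    prefixProd a i (l + 1) = prefixProd a i l * a i ⟨l, h⟩ := by
  simp [prefixProd, Finset.prod_range_succ, h]

theorem prefixProd_eq_prod (a : Fin m → Fin (k + 2) → F) (i : Fin m) :
    prefixProd a i (k + 2) = ∏ j, a i j := by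
  simp [prefixProd, Finset.prod_range]

/-- The coefficients of the combination of columns that clears the first column of
`calM m (k + 2) a` below its first entry. -/
def clearing (a : Fin m → Fin (k + 2) → F) : Fin (m * (k + 1) + 1) → F :=
  Fin.cons 1 fun q =>
    let p := finProdFinEquiv.symm q
    (-1) ^ (k - p.2 + 1) * prefixProd a p.1 (k - p.2 + 1)

theorem clearing_zero (a : Fin m → Fin (k + 2) → F) : clearing a 0 = 1 := rfl

theorem clearing_blockIndex (a : Fin m → Fin (k + 2) → F) (p : Fin m × Fin (k + 1)) :
    clearing a (blockIndex p) = (-1) ^ (k - p.2 + 1) * prefixProd a p.1 (k - p.2 + 1) := by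
  simp only [clearing, blockIndex, Fin.cons_succ, Equiv.symm_apply_apply]

theorem sum_clearing_mul_zero (a : Fin m → Fin (k + 2) → F) :
    ∑ q, clearing a q * succMatrix a 0 q = (-1) ^ (k + 1) * ∑ i, ∏ j, a i j := by
  rw [sum_eq]
  simp only [zero_zero, zero_blockIndex, clearing_blockIndex, mul_zero, zero_add, mul_ite,
    Finset.sum_ite_eq', Finset.mem_univ, if_true, Fin.val_zero, Nat.sub_zero, Finset.mul_sum]
  refine Finset.sum_congr rfl fun i _ => ?_
  rw [← prefixProd_eq_prod, prefixProd_succ a i (Nat.lt_succ_self (k + 1)), mul_assoc]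
  rfl

theorem sum_clearing_mul_blockIndex (a : Fin m → Fin (k + 2) → F) (p : Fin m × Fin (k + 1)) :
    ∑ q, clearing a q * succMatrix a (blockIndex p) q = 0 := by
  obtain ⟨i, r⟩ := p
  rw [sum_eq, Finset.sum_eq_single_of_mem i (Finset.mem_univ i)
    fun i' _ hi => Finset.sum_eq_zero fun r' _ => by simp [blockIndex_blockIndex, hi.symm]]
  simp only [blockIndex_zero, blockIndex_blockIndex, clearing_zero, clearing_blockIndex, if_true,
    one_mul]
  by_cases hr : (r : ℕ) = k
  · rw [Finset.sum_eq_single_of_mem r (Finset.mem_univ r) fun r' _ h => by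
      have : ¬ (r' : ℕ) = r + 1 := by omega
      simp [h.symm, this]]
    simp [hr, prefixProd]
  · have hlt : (r : ℕ) + 1 < k + 1 := by omega
    have hne : r ≠ ⟨r + 1, hlt⟩ := by simp [Fin.ext_iff]
    rw [Finset.sum_eq_add_of_mem r ⟨r + 1, hlt⟩ (Finset.mem_univ _) (Finset.mem_univ _) hne
      fun r' _ h => by
        have : ¬ (r' : ℕ) = r + 1 := fun h' => h.2 (Fin.ext h')
        simp [h.1.symm, this]]
    have hk : k - ((r : ℕ) + 1) + 1 = k - r := by omega
    rw [prefixProd_succ a i (l := k - r) (by omega)]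
    simp only [hr, hne, hk, if_true, if_false]
    ring

theorem det_succMatrix (a : Fin m → Fin (k + 2) → F) :
    (succMatrix a).det = (-1) ^ (k + 1) * ∑ i, ∏ j, a i j := by
  have hdet := Matrix.det_updateCol_sum (succMatrix a) 0 (clearing a)
  have hcol : (fun p => ∑ q, clearing a q * succMatrix a p q) =
      Pi.single 0 ((-1) ^ (k + 1) * ∑ i, ∏ j, a i j) := by
    ext p
    rcases eq_zero_or_eq_blockIndex p with rfl | ⟨p, rfl⟩
    · simpa using sum_clearing_mul_zero a
    · simpa [blockIndex_ne_zero] using sum_clearing_mul_blockIndex a p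
  have hupper : ((succMatrix a).updateCol 0
      (Pi.single 0 ((-1) ^ (k + 1) * ∑ i, ∏ j, a i j))).IsUpperTriangular := by
    intro p q hpq
    rcases eq_zero_or_eq_blockIndex p with rfl | ⟨p, rfl⟩
    · exact absurd hpq (Fin.not_lt_zero q)
    rcases eq_zero_or_eq_blockIndex q with rfl | ⟨q, rfl⟩
    · simp [blockIndex_ne_zero]
    rw [Matrix.updateCol_ne (blockIndex_ne_zero q), blockIndex_blockIndex]
    have hlt : (blockIndex q : ℕ) - 1 < (blockIndex p : ℕ) - 1 := by
      have := val_blockIndex_ne_zero q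
      have : (blockIndex q : ℕ) < blockIndex p := hpq
      omega
    rw [val_blockIndex_sub_one, val_blockIndex_sub_one] at hlt
    split_ifs with h₁ h₂ h₃
    · simp [h₁, h₂] at hlt
    · rw [h₁] at hlt
      omega
    · rfl
    · rfl
  simp only [smul_eq_mul] at hdet
  rw [hcol, Matrix.det_of_isUpperTriangular hupper, clearing_zero, one_mul,
    Fin.prod_univ_succ] at hdet
  rw [← hdet, Finset.prod_eq_one, mul_one, Matrix.updateCol_self, Pi.single_eq_same]
  intro q _
  rw [Matrix.updateCol_ne (Fin.succ_ne_zero q)]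
  obtain ⟨p, rfl⟩ := finProdFinEquiv.surjective q
  exact (blockIndex_blockIndex a p p).trans (by simp)

end calM

/-- `det 𝓜(a) = (-1)^{n+1} ∑_{i=1}^m ∏_{j=1}^n a_{i,j}`. -/
theorem det_calM {F : Type*} [Field F] (m n : ℕ) (hm : 1 ≤ m) (hn : 2 ≤ n)
    (a : Fin m → Fin n → F) :
    (calM m n a).det = (-1) ^ (n + 1) * ∑ i, ∏ j, a i j := by
  obtain ⟨k, rfl⟩ := Nat.exists_eq_add_of_le' hn
  refine (calM.det_succMatrix a).trans ?_
  ring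
end

section
/- Let p be a prime and let A be a finite subset of the field F_p = Z/pZ. Then for every natural number n ≥ 1, |8^n A^n − 8^n A^n| ≥ (1/8) · min(|A|^n, p), where 8^n A^n denotes the 8^n-fold sumset of the n-fold product set A^n and 8^n A^n − 8^n A^n its difference set. -/
open scoped Pointwise

/-- `prodSet n S` is the `n`-fold product set `{s₁ ⋯ sₙ : sᵢ ∈ S}`. -/
def prodSet {F : Type*} [Field F] (n : ℕ) (S : Set F) : Set F :=
  {x | ∃ g : Fin n → F, (∀ j, g j ∈ S) ∧ x = ∏ j, g j}

/-- `sumSet m S` is the `m`-fold sumset `{s₁ + ⋯ + sₘ : sᵢ ∈ S}`. -/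
def sumSet {F : Type*} [Field F] (m : ℕ) (S : Set F) : Set F :=
  {x | ∃ f : Fin m → F, (∀ i, f i ∈ S) ∧ x = ∑ i, f i}

section SumSet

variable {F : Type*} [Field F] {S T : Set F} {m k n : ℕ} {x y a : F}

theorem subset_sumSet_one : S ⊆ sumSet 1 S :=
  fun x hx => ⟨fun _ => x, fun _ => hx, by simp⟩

theorem sumSet_nonempty (hS : S.Nonempty) : (sumSet m S).Nonempty :=
  let ⟨s, hs⟩ := hS
  ⟨∑ _ : Fin m, s, fun _ => s, fun _ => hs, rfl⟩

theorem add_mem_sumSet (hx : x ∈ sumSet m S) (hy : y ∈ sumSet k S) :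
    x + y ∈ sumSet (m + k) S := by
  obtain ⟨f, hf, rfl⟩ := hx
  obtain ⟨g, hg, rfl⟩ := hy
  refine ⟨Fin.append f g, fun i => ?_, by simp [Fin.sum_univ_add]⟩
  induction i using Fin.addCases <;> simp [hf, hg]

theorem mul_mem_sumSet (h : ∀ s ∈ S, a * s ∈ T) (hx : x ∈ sumSet m S) :
    a * x ∈ sumSet m T := by
  obtain ⟨f, hf, rfl⟩ := hx
  exact ⟨fun i => a * f i, fun i => h _ (hf i), Finset.mul_sum _ _ _⟩

theorem mul_mem_prodSet (ha : a ∈ S) (hx : x ∈ prodSet n S) : a * x ∈ prodSet (n + 1) S := by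
  obtain ⟨g, hg, rfl⟩ := hx
  refine ⟨Fin.cons a g, fun i => ?_, by simp [Fin.prod_univ_succ]⟩
  induction i using Fin.cases <;> simp [ha, hg]

theorem pow_mem_prodSet (ha : a ∈ S) : a ^ n ∈ prodSet n S :=
  ⟨fun _ => a, fun _ => ha, by simp⟩

theorem prodSet_one : prodSet 1 S = S := by
  ext x
  constructor
  · rintro ⟨g, hg, rfl⟩
    simpa using hg 0
  · intro hx
    simpa using pow_mem_prodSet (n := 1) hx

theorem sub_mem_sub_sumSet_one (hx : x ∈ S) (hy : y ∈ S) : x - y ∈ sumSet 1 S - sumSet 1 S :=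
  Set.sub_mem_sub (subset_sumSet_one hx) (subset_sumSet_one hy)

theorem add_mem_sub_sumSet (hx : x ∈ sumSet m S - sumSet m S)
    (hy : y ∈ sumSet k S - sumSet k S) : x + y ∈ sumSet (m + k) S - sumSet (m + k) S := by
  obtain ⟨x₁, hx₁, x₂, hx₂, rfl⟩ := hx
  obtain ⟨y₁, hy₁, y₂, hy₂, rfl⟩ := hy
  exact ⟨_, add_mem_sumSet hx₁ hy₁, _, add_mem_sumSet hx₂ hy₂, add_sub_add_comm _ _ _ _⟩

theorem neg_mem_sub_sumSet (hx : x ∈ sumSet m S - sumSet m S) :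
    -x ∈ sumSet m S - sumSet m S := by
  obtain ⟨x₁, hx₁, x₂, hx₂, rfl⟩ := hx
  exact ⟨_, hx₂, _, hx₁, (neg_sub _ _).symm⟩

theorem sub_mem_sub_sumSet (hx : x ∈ sumSet m S - sumSet m S)
    (hy : y ∈ sumSet k S - sumSet k S) : x - y ∈ sumSet (m + k) S - sumSet (m + k) S :=
  sub_eq_add_neg x y ▸ add_mem_sub_sumSet hx (neg_mem_sub_sumSet hy)

theorem zero_mem_sub_sumSet (hS : S.Nonempty) : (0 : F) ∈ sumSet m S - sumSet m S :=
  let ⟨_, hs⟩ := sumSet_nonempty hS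
  ⟨_, hs, _, hs, sub_self _⟩

theorem sub_sumSet_mono (hS : S.Nonempty) (h : m ≤ k) :
    sumSet m S - sumSet m S ⊆ sumSet k S - sumSet k S := by
  intro x hx
  simpa [Nat.add_sub_cancel' h] using add_mem_sub_sumSet hx (zero_mem_sub_sumSet (m := k - m) hS)

theorem mul_mem_sub_sumSet_prodSet (ha : a ∈ S)
    (hx : x ∈ sumSet m (prodSet n S) - sumSet m (prodSet n S)) :
    a * x ∈ sumSet m (prodSet (n + 1) S) - sumSet m (prodSet (n + 1) S) := by
  obtain ⟨x₁, hx₁, x₂, hx₂, rfl⟩ := hx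
  have h : ∀ s ∈ prodSet n S, a * s ∈ prodSet (n + 1) S := fun s hs => mul_mem_prodSet ha hs
  exact ⟨_, mul_mem_sumSet h hx₁, _, mul_mem_sumSet h hx₂, (mul_sub _ _ _).symm⟩

end SumSet

open Finset

theorem card_sq_le_card_image_mul_card_filter_eq {α β : Type*} [DecidableEq β]
    (f : α → β) (s : Finset α) :
    #s ^ 2 ≤ #(s.image f) * #{x ∈ s ×ˢ s | f x.1 = f x.2} := by
  have h : #{x ∈ s ×ˢ s | f x.1 = f x.2} = ∑ b ∈ s.image f, #{a ∈ s | f a = b} ^ 2 := by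
    rw [card_eq_sum_card_fiberwise (f := fun x => f x.1) (t := s.image f)]
    · refine sum_congr rfl fun b _ => ?_
      rw [sq, ← card_product]
      congr 1
      ext ⟨x, y⟩
      simp only [mem_filter, mem_product]
      grind
    · intro x hx
      simp only [coe_filter, mem_product, Set.mem_ofPred_eq] at hx
      exact mem_coe.2 (mem_image_of_mem f hx.1.1)
  rw [h, card_eq_sum_card_image f s]
  simpa using sq_sum_le_card_mul_sum_sq (s := s.image f) (f := fun b => #{a ∈ s | f a = b})

/-- Some dilate `ξ A` satisfies `|D + ξ A| ≥ |D||A|q / (|D||A| + q)` in a field of order `q`. -/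
theorem exists_card_image_add_mul_ge {F : Type*} [Field F] [Fintype F] [DecidableEq F]
    (D A : Finset F) :
    ∃ ξ : F, #D * #A * Fintype.card F ≤
      #((D ×ˢ A).image fun x => x.1 + ξ * x.2) * (#D * #A + Fintype.card F) := by
  set s := D ×ˢ A with hs
  set q := Fintype.card F
  have hq : 0 < q := Fintype.card_pos
  obtain ⟨ξ, -, hξ⟩ : ∃ ξ ∈ (univ : Finset F),
      q * #{x ∈ s ×ˢ s | x.1.1 + ξ * x.1.2 = x.2.1 + ξ * x.2.2} ≤ #s * (#s + q) := by
    refine exists_le_of_sum_le univ_nonempty ?_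
    rw [← mul_sum, sum_const, card_univ, smul_eq_mul]
    gcongr q * ?_
    simp_rw [card_filter]
    rw [sum_comm]
    calc ∑ x ∈ s ×ˢ s, ∑ ξ : F, (if x.1.1 + ξ * x.1.2 = x.2.1 + ξ * x.2.2 then 1 else 0)
        ≤ ∑ x ∈ s ×ˢ s, (1 + if x.1 = x.2 then q else 0) := by
          refine sum_le_sum fun x _ => ?_
          rw [← card_filter]
          split_ifs with h
          · exact (card_le_univ _).trans (Nat.le_add_left _ _)
          · rw [add_zero, card_le_one]
            intro ξ hξ η hη
            simp only [mem_filter, mem_univ, true_and] at hξ hη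
            have h0 : (ξ - η) * (x.1.2 - x.2.2) = 0 := by linear_combination hξ - hη
            rcases mul_eq_zero.1 h0 with h1 | h1
            · exact sub_eq_zero.1 h1
            · have h2 := sub_eq_zero.1 h1
              refine absurd (Prod.ext ?_ h2) h
              rw [h2] at hξ
              exact add_right_cancel hξ
      _ = #s * (#s + q) := by
          rw [sum_add_distrib, sum_product (f := fun x => if x.1 = x.2 then q else 0)]
          simp [mul_add]
  refine ⟨ξ, ?_⟩
  have hcs := card_sq_le_card_image_mul_card_filter_eq (fun x : F × F => x.1 + ξ * x.2) s
  rw [← card_product, ← hs]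
  rcases Nat.eq_zero_or_pos #s with h0 | h0
  · simp [h0]
  refine Nat.le_of_mul_le_mul_left ?_ h0
  calc #s * (#s * q) = #s ^ 2 * q := by ring
    _ ≤ _ := Nat.mul_le_mul_right q hcs
    _ = _ := by rw [mul_assoc, mul_comm _ q]
    _ ≤ _ := Nat.mul_le_mul_left _ hξ
    _ = _ := by ring

/-- If `D` and `A` are finite in `𝔽_p` and `t ≠ 0`, then for suitable differences `v` of `A` and
`w` of `D`, and `e ∈ {0, t}`, the set `v D + (w + e v) A` is large. -/
theorem exists_card_image_sub_mul_add_ge {p : ℕ} [Fact p.Prime] {D A : Finset (ZMod p)}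
    (hD : D.Nonempty) (hA : 1 < #A) {t : ZMod p} (ht : t ≠ 0) :
    ∃ a₁ ∈ A, ∃ a₂ ∈ A, ∃ d₁ ∈ D, ∃ d₂ ∈ D, ∃ e : ZMod p, (e = 0 ∨ e = t) ∧
      #D * #A * p ≤ #((D ×ˢ A).image fun x =>
        (a₁ - a₂) * x.1 + (d₁ - d₂ + e * (a₁ - a₂)) * x.2) * (#D * #A + p) := by
  have key : ∀ {a₁ a₂ d₁ d₂ e ξ : ZMod p}, a₁ ≠ a₂ → d₁ - d₂ + e * (a₁ - a₂) = ξ * (a₁ - a₂) →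
      #((D ×ˢ A).image fun x => (a₁ - a₂) * x.1 + (d₁ - d₂ + e * (a₁ - a₂)) * x.2) =
        #((D ×ˢ A).image fun x => x.1 + ξ * x.2) := by
    intro a₁ a₂ d₁ d₂ e ξ ha h
    rw [← card_image_of_injective ((D ×ˢ A).image fun x => x.1 + ξ * x.2)
      (mul_right_injective₀ (sub_ne_zero.2 ha)), image_image]
    congr 2
    ext x
    simp only [h, Function.comp_apply]
    ring
  by_cases hQ : ∀ ξ : ZMod p, ∃ a₁ ∈ A, ∃ a₂ ∈ A, ∃ d₁ ∈ D, ∃ d₂ ∈ D,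
      a₁ ≠ a₂ ∧ d₁ - d₂ = ξ * (a₁ - a₂)
  · obtain ⟨ξ, hξ⟩ := exists_card_image_add_mul_ge D A
    obtain ⟨a₁, ha₁, a₂, ha₂, d₁, hd₁, d₂, hd₂, ha, h⟩ := hQ ξ
    refine ⟨a₁, ha₁, a₂, ha₂, d₁, hd₁, d₂, hd₂, 0, Or.inl rfl, ?_⟩
    rw [key ha (ξ := ξ) (by simpa using h)]
    simpa [ZMod.card] using hξ
  · obtain ⟨ξ, ⟨a₁, ha₁, a₂, ha₂, d₁, hd₁, d₂, hd₂, ha, h⟩, hξt⟩ : ∃ ξ : ZMod p,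
        (∃ a₁ ∈ A, ∃ a₂ ∈ A, ∃ d₁ ∈ D, ∃ d₂ ∈ D, a₁ ≠ a₂ ∧ d₁ - d₂ = ξ * (a₁ - a₂)) ∧
        ¬ ∃ a₁ ∈ A, ∃ a₂ ∈ A, ∃ d₁ ∈ D, ∃ d₂ ∈ D,
          a₁ ≠ a₂ ∧ d₁ - d₂ = (ξ + t) * (a₁ - a₂) := by
      by_contra! hstep
      refine hQ fun ξ => ?_
      have hind : ∀ k : ℕ, ∃ a₁ ∈ A, ∃ a₂ ∈ A, ∃ d₁ ∈ D, ∃ d₂ ∈ D,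
          a₁ ≠ a₂ ∧ d₁ - d₂ = (k * t) * (a₁ - a₂) := by
        intro k
        induction k with
        | zero =>
          obtain ⟨a₁, ha₁, a₂, ha₂, ha⟩ := one_lt_card.1 hA
          obtain ⟨d, hd⟩ := hD
          exact ⟨a₁, ha₁, a₂, ha₂, d, hd, d, hd, ha, by simp⟩
        | succ k ih =>
          have := hstep _ ih
          rwa [show ((k : ZMod p) * t + t) = ((k + 1 : ℕ) : ZMod p) * t by push_cast; ring] at this
      simpa [ht] using hind (ξ / t).val
    refine ⟨a₁, ha₁, a₂, ha₂, d₁, hd₁, d₂, hd₂, t, Or.inr rfl, ?_⟩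
    rw [key ha (ξ := ξ + t) (by rw [h]; ring), card_image_of_injOn, card_product]
    · gcongr
      exact Nat.le_add_left _ _
    · rintro ⟨d, a⟩ hx ⟨d', a'⟩ hy hxy
      simp only [coe_product, Set.mem_prod, mem_coe] at hx hy hxy
      by_cases haa : a' = a
      · subst haa
        exact Prod.ext (add_right_cancel hxy) rfl
      · exact absurd ⟨a', hy.2, a, hx.2, d, hx.1, d', hy.1, haa, by linear_combination hxy⟩ hξt

/-- The recursive bound `1 / |D_{n+1}| ≤ 1 / (|A||D_n|) + 1 / p`, cleared of denominators,
for `D_n = 8ⁿ Aⁿ - 8ⁿ Aⁿ`. -/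
theorem ncard_sub_sumSet_prodSet_succ_ge {p : ℕ} [Fact p.Prime] {A : Finset (ZMod p)}
    (hA : 1 < #A) (n : ℕ) :
    let d := fun n : ℕ => (sumSet (8 ^ n) (prodSet n (A : Set (ZMod p))) -
      sumSet (8 ^ n) (prodSet n (A : Set (ZMod p)))).ncard
    d (n + 2) * (d (n + 1) * #A + p) ≥ d (n + 1) * #A * p := by
  intro d
  obtain ⟨b, hb, hb0⟩ := exists_mem_ne hA 0
  have hne : ∀ n, (prodSet n (A : Set (ZMod p))).Nonempty := fun n =>
    ⟨_, pow_mem_prodSet (mem_coe.2 hb)⟩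
  set X := sumSet (8 ^ (n + 1)) (prodSet (n + 1) (A : Set (ZMod p)))
  obtain ⟨D, hD⟩ : ∃ D : Finset (ZMod p), (D : Set (ZMod p)) = X - X :=
    ⟨(Set.toFinite (X - X)).toFinset, Set.Finite.coe_toFinset _⟩
  have hmem : ∀ {x}, x ∈ D → x ∈ X - X := fun hx => hD ▸ mem_coe.2 hx
  have hDne : D.Nonempty := by
    rw [← coe_nonempty, hD]
    exact ⟨0, zero_mem_sub_sumSet (hne _)⟩
  have hdD : d (n + 1) = #D := by
    rw [← Set.ncard_coe_finset, hD]
  obtain ⟨a₁, ha₁, a₂, ha₂, d₁, hd₁, d₂, hd₂, e, he, h⟩ :=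
    exists_card_image_sub_mul_add_ge hDne hA (pow_ne_zero n hb0)
  rw [hdD]
  refine h.trans (Nat.mul_le_mul_right _ ?_)
  rw [← Set.ncard_coe_finset]
  refine Set.ncard_le_ncard ?_ (Set.toFinite _)
  intro y hy
  obtain ⟨⟨x, a⟩, hxa, rfl⟩ := mem_image.1 (mem_coe.1 hy)
  obtain ⟨hx, ha⟩ := mem_product.1 hxa
  have hmul : ∀ {a x}, a ∈ A → x ∈ D → a * x ∈
      sumSet (8 ^ (n + 1)) (prodSet (n + 2) (A : Set (ZMod p))) -
        sumSet (8 ^ (n + 1)) (prodSet (n + 2) (A : Set (ZMod p))) :=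
    fun ha hx => mul_mem_sub_sumSet_prodSet (mem_coe.2 ha) (hmem hx)
  have hlast : e * (a₁ - a₂) * a ∈ sumSet 1 (prodSet (n + 2) (A : Set (ZMod p))) -
      sumSet 1 (prodSet (n + 2) (A : Set (ZMod p))) := by
    rcases he with rfl | rfl
    · simpa using zero_mem_sub_sumSet (m := 1) (hne (n + 2))
    · have hp : ∀ {c}, c ∈ A → a * (c * b ^ n) ∈ prodSet (n + 2) (A : Set (ZMod p)) :=
        fun hc => mul_mem_prodSet (mem_coe.2 ha)
          (mul_mem_prodSet (mem_coe.2 hc) (pow_mem_prodSet (mem_coe.2 hb)))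
      convert sub_mem_sub_sumSet_one (hp ha₁) (hp ha₂) using 1
      ring
  have hsum := add_mem_sub_sumSet (add_mem_sub_sumSet
    (sub_mem_sub_sumSet (hmul ha₁ hx) (hmul ha₂ hx))
    (sub_mem_sub_sumSet (hmul ha hd₁) (hmul ha hd₂))) hlast
  have hle : 8 ^ (n + 1) + 8 ^ (n + 1) + (8 ^ (n + 1) + 8 ^ (n + 1)) + 1 ≤ 8 ^ (n + 2) := by
    have := Nat.one_le_pow (n + 1) 8 (by norm_num)
    rw [pow_succ 8 (n + 1)]
    omega
  convert sub_sumSet_mono (hne _) hle hsum using 1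
  ring

/-- For `A ⊆ 𝔽_p` and `n ≥ 1`, `|8ⁿ Aⁿ - 8ⁿ Aⁿ| ≥ (1/8) · min(|A|ⁿ, p)`. -/
theorem card_difference_sumSet_prodSet_ge {p : ℕ} [Fact p.Prime] (A : Finset (ZMod p)) :
    ∀ n : ℕ, 1 ≤ n →
      (1 / 8 : ℝ) * min ((A.card : ℝ) ^ n) (p : ℝ) ≤
        ((sumSet (8 ^ n) (prodSet n (A : Set (ZMod p))) -
          sumSet (8 ^ n) (prodSet n (A : Set (ZMod p)))).ncard : ℝ) := by
  intro n hn
  rcases lt_or_ge 1 A.card with hA | hA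
  · have hp : (0 : ℝ) < p := mod_cast (Fact.out : p.Prime).pos
    have ha : (2 : ℝ) ≤ A.card := mod_cast hA
    have hne : A.Nonempty := Finset.card_pos.1 (by omega)
    have main : ∀ n : ℕ, (A.card : ℝ) ^ (n + 1) * p ≤
        ((sumSet (8 ^ (n + 1)) (prodSet (n + 1) (A : Set (ZMod p))) -
          sumSet (8 ^ (n + 1)) (prodSet (n + 1) (A : Set (ZMod p)))).ncard : ℝ) *
          (2 * (A.card : ℝ) ^ (n + 1) + p) := by
      intro n
      induction n with
      | zero =>
        obtain ⟨b, hb⟩ := hne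
        have hsub : A.card ≤ (sumSet (8 ^ (0 + 1)) (prodSet (0 + 1) (A : Set (ZMod p))) -
            sumSet (8 ^ (0 + 1)) (prodSet (0 + 1) (A : Set (ZMod p)))).ncard := by
          rw [zero_add, prodSet_one, ← Set.ncard_coe_finset,
            ← Set.ncard_image_of_injective (A : Set (ZMod p)) (sub_left_injective (b := b))]
          refine Set.ncard_le_ncard ?_ (Set.toFinite _)
          rintro _ ⟨x, hx, rfl⟩
          exact sub_sumSet_mono ⟨b, hb⟩ (by norm_num) (sub_mem_sub_sumSet_one hx hb)
        have : (A.card : ℝ) ≤ _ := Nat.cast_le.2 hsub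
        calc (A.card : ℝ) ^ (0 + 1) * p ≤ A.card * (2 * (A.card : ℝ) ^ (0 + 1) + p) := by
              rw [zero_add, pow_one]
              gcongr
              linarith
          _ ≤ _ := by gcongr
      | succ n ih =>
        have hstep := ncard_sub_sumSet_prodSet_succ_ge hA n
        simp only [ge_iff_le] at hstep
        generalize (sumSet (8 ^ (n + 1)) (prodSet (n + 1) (A : Set (ZMod p))) -
          sumSet (8 ^ (n + 1)) (prodSet (n + 1) (A : Set (ZMod p)))).ncard = d at *
        generalize (sumSet (8 ^ (n + 2)) (prodSet (n + 2) (A : Set (ZMod p))) -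
          sumSet (8 ^ (n + 2)) (prodSet (n + 2) (A : Set (ZMod p)))).ncard = d' at *
        have hstep' : (d : ℝ) * A.card * p ≤ d' * (d * A.card + p) := mod_cast hstep
        rw [pow_succ _ (n + 1)]
        have hX : (0 : ℝ) < (A.card : ℝ) ^ (n + 1) := by positivity
        generalize (A.card : ℝ) ^ (n + 1) = X at *
        generalize (A.card : ℝ) = a at *
        have hd : (0 : ℝ) ≤ d := d.cast_nonneg
        generalize (d : ℝ) = D at *
        generalize (d' : ℝ) = D' at *
        have hpos : 0 < D * a + p := by positivity
        refine le_of_mul_le_mul_left ?_ hpos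
        calc (D * a + p) * (X * a * p) = D * a * p * (X * a) + X * p * (a * p) := by ring
          _ ≤ D * a * p * (X * a) + D * (a * X + p) * (a * p) := by
            have hXD : X * p ≤ D * (a * X + p) := ih.trans (by gcongr)
            exact add_le_add_right (mul_le_mul_of_nonneg_right hXD (by positivity)) _
          _ = D * a * p * (2 * (X * a) + p) := by ring
          _ ≤ D' * (D * a + p) * (2 * (X * a) + p) := by gcongr
          _ = _ := by ring
    obtain ⟨n, rfl⟩ := Nat.exists_eq_add_of_le' hn
    have hX : (0 : ℝ) < (A.card : ℝ) ^ (n + 1) := by positivity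
    have h := main n
    generalize (A.card : ℝ) ^ (n + 1) = X at *
    rcases le_total X p with hXp | hXp
    · rw [min_eq_left hXp]
      nlinarith
    · rw [min_eq_right hXp]
      nlinarith
  · rcases A.eq_empty_or_nonempty with rfl | ⟨b, hb⟩
    · rw [Finset.card_empty, Nat.cast_zero, zero_pow (by omega), min_eq_left (Nat.cast_nonneg _),
        mul_zero]
      exact Nat.cast_nonneg _
    · have h1 : (A.card : ℝ) ^ n ≤ 1 := pow_le_one₀ (Nat.cast_nonneg _) (mod_cast hA)
      have h2 : (1 : ℝ) ≤ ((sumSet (8 ^ n) (prodSet n (A : Set (ZMod p))) -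
          sumSet (8 ^ n) (prodSet n (A : Set (ZMod p)))).ncard : ℝ) := by
        refine Nat.one_le_cast.2 (Set.ncard_pos (Set.toFinite _) |>.2 ⟨0, ?_⟩)
        exact zero_mem_sub_sumSet ⟨_, pow_mem_prodSet (Finset.mem_coe.2 hb)⟩
      linarith [min_le_left ((A.card : ℝ) ^ n) (p : ℝ)]
end

section
/- Let p be a prime and let A be a finite subset of the field F_p = Z/pZ with |A| ≥ 2. Then for every natural number n ≥ 1, |D_{8^{n+1}}(A)| ≥ (1/8) · min(|A|^n, p). -/
section DilatedSums

open Finset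

variable {F : Type*} [Field F]

/-- `ξ` is a quotient of a difference of `X` by a nonzero difference of `Y`. -/
def IsDiffQuotient (X Y : Finset F) (ξ : F) : Prop :=
  ∃ x₁ ∈ X, ∃ x₂ ∈ X, ∃ y₁ ∈ Y, ∃ y₂ ∈ Y, y₁ ≠ y₂ ∧ ξ * (y₁ - y₂) = x₁ - x₂

theorem IsDiffQuotient.mono {X X' Y : Finset F} (hX : X ⊆ X') {ξ : F}
    (h : IsDiffQuotient X Y ξ) : IsDiffQuotient X' Y ξ := by
  obtain ⟨x₁, hx₁, x₂, hx₂, h⟩ := h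
  exact ⟨x₁, hX hx₁, x₂, hX hx₂, h⟩

variable [DecidableEq F]

/-- The dilated sum `X + ξ • Y`. -/
def dilatedSum (X Y : Finset F) (ξ : F) : Finset F :=
  (X ×ˢ Y).image fun q => q.1 + ξ * q.2

/-- Some dilate `ξ` makes `X + ξ • Y` almost as large as possible. -/
theorem exists_card_dilatedSum_ge [Fintype F] (X Y : Finset F) :
    ∃ ξ : F, Fintype.card F * (#X * #Y) ≤ #(dilatedSum X Y ξ) * (Fintype.card F + #X * #Y) := by
  set P := X ×ˢ Y with hP
  have hPc : #P = #X * #Y := card_product X Y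
  let f : F → F × F → F := fun ξ q => q.1 + ξ * q.2
  let E : F → ℕ := fun ξ => ∑ q ∈ P, ∑ q' ∈ P, if f ξ q = f ξ q' then 1 else 0
  have hcs : ∀ ξ, #P ^ 2 ≤ #(dilatedSum X Y ξ) * E ξ := by
    intro ξ
    have h1 : #P = ∑ z ∈ P.image (f ξ), #{q ∈ P | f ξ q = z} :=
      card_eq_sum_card_image (f ξ) P
    have h2 : E ξ = ∑ z ∈ P.image (f ξ), #{q ∈ P | f ξ q = z} ^ 2 := by
      have : ∀ q ∈ P, (∑ q' ∈ P, if f ξ q = f ξ q' then 1 else 0) =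
          #{q' ∈ P | f ξ q' = f ξ q} := by
        intro q _
        rw [card_filter]
        exact sum_congr rfl fun q' _ => by simp only [eq_comm]
      simp only [E]
      rw [sum_congr rfl this, ← sum_fiberwise_of_maps_to (g := f ξ) (t := P.image (f ξ))
        (fun q hq => mem_image_of_mem _ hq)]
      refine sum_congr rfl fun z _ => ?_
      rw [sum_congr rfl (g := fun _ => #{q ∈ P | f ξ q = z}), sum_const, smul_eq_mul, sq]
      intro q hq
      rw [(mem_filter.1 hq).2]
    rw [h2]
    conv_lhs => rw [h1]
    exact sq_sum_le_card_mul_sum_sq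
  have hsum : ∑ ξ : F, E ξ ≤ ∑ _ξ : F, #P + #P ^ 2 := by
    have h1 : ∑ ξ : F, E ξ = ∑ q ∈ P, ∑ q' ∈ P, #{ξ : F | f ξ q = f ξ q'} := by
      simp only [E, card_filter]
      rw [sum_comm]
      exact sum_congr rfl fun q _ => sum_comm
    have h2 : ∀ q ∈ P, ∀ q' ∈ P, #{ξ : F | f ξ q = f ξ q'} ≤
        (if q = q' then Fintype.card F else 0) + 1 := by
      intro q _ q' _
      split_ifs with h
      · exact (card_le_univ _).trans (Nat.le_succ _)
      · rw [zero_add, card_le_one]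
        intro ξ hξ η hη
        simp only [mem_filter, mem_univ, true_and, f] at hξ hη
        have h3 : (ξ - η) * (q.2 - q'.2) = 0 := by linear_combination hξ - hη
        rcases mul_eq_zero.1 h3 with h3 | h3
        · exact sub_eq_zero.1 h3
        · have h4 := sub_eq_zero.1 h3
          rw [h4] at hξ
          exact absurd (Prod.ext (add_right_cancel hξ) h4) h
    rw [h1]
    calc _ ≤ ∑ q ∈ P, ∑ q' ∈ P, ((if q = q' then Fintype.card F else 0) + 1) :=
          sum_le_sum fun q hq => sum_le_sum fun q' hq' => h2 q hq q' hq'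
      _ = _ := by
          simp only [sum_add_distrib, sum_ite_eq, sum_const, smul_eq_mul, mul_one, card_univ]
          rw [sum_congr rfl (g := fun _ => Fintype.card F) (fun q hq => if_pos hq), sum_const,
            smul_eq_mul]
          ring
  obtain ⟨ξ, hξ⟩ : ∃ ξ : F, Fintype.card F * E ξ ≤ Fintype.card F * #P + #P ^ 2 := by
    by_contra! hcon
    have h1 := sum_lt_sum_of_nonempty (s := (univ : Finset F)) univ_nonempty fun ξ _ => hcon ξ
    rw [← mul_sum, sum_const, smul_eq_mul, card_univ] at h1
    have h2 := lt_of_mul_lt_mul_left h1 (Nat.zero_le _)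
    rw [sum_const, smul_eq_mul, card_univ] at hsum
    omega
  refine ⟨ξ, ?_⟩
  rw [← hPc]
  rcases Nat.eq_zero_or_pos #P with h0 | h0
  · simp [h0]
  · refine le_of_mul_le_mul_left (a := #P) ?_ h0
    calc #P * (Fintype.card F * #P) = Fintype.card F * #P ^ 2 := by ring
      _ ≤ Fintype.card F * (#(dilatedSum X Y ξ) * E ξ) := Nat.mul_le_mul_left _ (hcs ξ)
      _ = #(dilatedSum X Y ξ) * (Fintype.card F * E ξ) := by ring
      _ ≤ #(dilatedSum X Y ξ) * (Fintype.card F * #P + #P ^ 2) := Nat.mul_le_mul_left _ hξ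
      _ = _ := by ring

theorem card_dilatedSum_of_not_isDiffQuotient {X Y : Finset F} {ξ : F}
    (h : ¬ IsDiffQuotient X Y ξ) : #(dilatedSum X Y ξ) = #X * #Y := by
  rw [dilatedSum, card_image_of_injOn, card_product]
  rintro ⟨x, y⟩ hq ⟨x', y'⟩ hq' he
  simp only [coe_product, Set.mem_prod, mem_coe] at hq hq' he
  by_cases hy : y = y'
  · subst hy
    rw [add_right_cancel he]
  · exact absurd ⟨x', hq'.1, x, hq.1, y, hq.2, y', hq'.2, hy, by linear_combination he⟩ h

theorem card_le_of_forall_isDiffQuotient [Fintype F] {X Y : Finset F}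
    (h : ∀ ξ, IsDiffQuotient X Y ξ) : Fintype.card F ≤ (#X * #Y) ^ 2 := by
  have hsub : (univ : Finset F) ⊆ ((X ×ˢ Y) ×ˢ (X ×ˢ Y)).image
      fun q => (q.1.1 - q.2.1) / (q.1.2 - q.2.2) := by
    intro ξ _
    obtain ⟨x₁, hx₁, x₂, hx₂, y₁, hy₁, y₂, hy₂, hne, he⟩ := h ξ
    refine mem_image.2 ⟨((x₁, y₁), (x₂, y₂)), by simp [hx₁, hx₂, hy₁, hy₂], ?_⟩
    exact (eq_div_of_mul_eq (sub_ne_zero.2 hne) he).symm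
  calc Fintype.card F = #(univ : Finset F) := card_univ.symm
    _ ≤ _ := card_le_card hsub
    _ ≤ _ := card_image_le
    _ = _ := by simp only [card_product]; ring

theorem card_dilatedSum_le_of_mul_mem {X Y Z : Finset F} {ξ d : F} (hd : d ≠ 0)
    (h : ∀ x ∈ X, ∀ y ∈ Y, d * x + d * ξ * y ∈ Z) : #(dilatedSum X Y ξ) ≤ #Z := by
  refine card_le_card_of_injOn (fun z => d * z) ?_ fun a _ b _ hab => mul_left_cancel₀ hd hab
  intro z hz
  obtain ⟨⟨x, y⟩, hq, rfl⟩ := mem_image.1 (mem_coe.1 hz)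
  have := h x (mem_product.1 hq).1 y (mem_product.1 hq).2
  simpa only [mul_add, mul_assoc, mem_coe] using this

end DilatedSums

section Representable

open Matrix

variable {F : Type*} [Field F]

/-- `v = r L⁻¹ c` for a `k × k` matrix `L` of determinant one and vectors `r`, `c`, all with
entries in `B`. -/
def IsRepresentable (B : Finset F) (k : ℕ) (v : F) : Prop :=
  ∃ (L : Matrix (Fin k) (Fin k) F) (r c x : Fin k → F),
    (∀ i j, L i j ∈ B) ∧ (∀ i, r i ∈ B) ∧ (∀ i, c i ∈ B) ∧
      L.det = 1 ∧ L *ᵥ x = c ∧ r ⬝ᵥ x = v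

variable {B : Finset F} {k l : ℕ} {u v : F}

theorem IsRepresentable.of_fintype {ι : Type*} [Fintype ι] [DecidableEq ι]
    (hk : Fintype.card ι = k) (L : Matrix ι ι F) (r c x : ι → F)
    (hL : ∀ i j, L i j ∈ B) (hr : ∀ i, r i ∈ B) (hc : ∀ i, c i ∈ B)
    (hdet : L.det = 1) (hx : L *ᵥ x = c) (hv : r ⬝ᵥ x = v) : IsRepresentable B k v := by
  let e : Fin k ≃ ι := (Fintype.equivFinOfCardEq hk).symm
  refine ⟨L.submatrix e e, r ∘ e, c ∘ e, x ∘ e, fun i j => hL _ _, fun i => hr _, fun i => hc _,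
    ?_, ?_, ?_⟩
  · rw [det_submatrix_equiv_self, hdet]
  · rw [← hx, submatrix_mulVec_equiv]
    simp [Function.comp_assoc]
  · rw [← hv]
    exact comp_equiv_dotProduct_comp_equiv r x e

theorem IsRepresentable.add (h0 : (0 : F) ∈ B) (hu : IsRepresentable B k u)
    (hv : IsRepresentable B l v) : IsRepresentable B (k + l) (u + v) := by
  obtain ⟨L, r, c, x, hL, hr, hc, hd, hx, rfl⟩ := hu
  obtain ⟨L', r', c', x', hL', hr', hc', hd', hx', rfl⟩ := hv
  refine .of_fintype (ι := Fin k ⊕ Fin l) (by simp) (fromBlocks L 0 0 L') (Sum.elim r r')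
    (Sum.elim c c') (Sum.elim x x') ?_ ?_ ?_ ?_ ?_ ?_
  · rintro (i | i) (j | j) <;> simp [*]
  · rintro (i | i) <;> simp [*]
  · rintro (i | i) <;> simp [*]
  · rw [det_fromBlocks_zero₂₁, hd, hd', one_mul]
  · simp [fromBlocks_mulVec, hx, hx']
  · simp [dotProduct]

theorem IsRepresentable.neg (h0 : (0 : F) ∈ B) (h1 : (1 : F) ∈ B) (hv : IsRepresentable B k v) :
    IsRepresentable B (k + 1) (-v) := by
  obtain ⟨L, r, c, x, hL, hr, hc, hd, hx, rfl⟩ := hv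
  refine .of_fintype (ι := Unit ⊕ Fin k) (by simp [add_comm])
    (fromBlocks 1 (replicateRow Unit r) 0 L) (Sum.elim 1 0)
    (Sum.elim 0 c) (Sum.elim (fun _ => -(r ⬝ᵥ x)) x) ?_ ?_ ?_ ?_ ?_ ?_
  · rintro (i | i) (j | j) <;> simp [*]
  · rintro (i | i) <;> simp [*]
  · rintro (i | i) <;> simp [*]
  · rw [det_fromBlocks_zero₂₁, hd, det_one, one_mul]
  · ext (i | i)
    · simp [mulVec, dotProduct]
    · simp [fromBlocks_mulVec, hx]
  · simp [dotProduct]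

theorem IsRepresentable.mul (h0 : (0 : F) ∈ B) (h1 : (1 : F) ∈ B) (hu : IsRepresentable B k u)
    (hv : IsRepresentable B l v) : IsRepresentable B (k + l + 1) (u * v) := by
  obtain ⟨L, r, c, x, hL, hr, hc, hd, hx, rfl⟩ := hu
  obtain ⟨L', r', c', x', hL', hr', hc', hd', hx', rfl⟩ := hv
  refine .of_fintype (ι := Fin k ⊕ (Unit ⊕ Fin l)) (by simp; omega)
    (fromBlocks L (fromCols (replicateCol Unit c) 0) 0
      (fromBlocks 1 (replicateRow Unit r') 0 L')) (Sum.elim r 0)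
    (Sum.elim 0 (Sum.elim 0 c'))
    (Sum.elim ((r' ⬝ᵥ x') • x) (Sum.elim (fun _ => -(r' ⬝ᵥ x')) x')) ?_ ?_ ?_ ?_ ?_ ?_
  · rintro (i | i | i) (j | j | j) <;> simp [*]
  · rintro (i | i) <;> simp [*]
  · rintro (i | i | i) <;> simp [*]
  · rw [det_fromBlocks_zero₂₁, det_fromBlocks_zero₂₁, hd, hd', det_one, one_mul, one_mul]
  · ext (i | i | i)
    · have hY : replicateCol Unit c *ᵥ (fun _ => -(r' ⬝ᵥ x')) = -((r' ⬝ᵥ x') • c) := by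
        ext; simp [mulVec, dotProduct, mul_comm]
      simp [fromBlocks_mulVec, fromCols_mulVec, mulVec_smul, hx, hY]
    · simp [mulVec, dotProduct]
    · simp [fromBlocks_mulVec, hx']
  · rw [sumElim_dotProduct_sumElim, zero_dotProduct, add_zero, dotProduct_smul, smul_eq_mul,
      mul_comm]

theorem isRepresentable_of_mem (h1 : (1 : F) ∈ B) (hv : v ∈ B) : IsRepresentable B 1 v :=
  ⟨1, 1, fun _ => v, fun _ => v, fun i j => by rwa [Subsingleton.elim i j, one_apply_eq],
    fun _ => h1,
    fun _ => hv, det_one, one_mulVec _, by simp [dotProduct]⟩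

theorem IsRepresentable.mono (h0 : (0 : F) ∈ B) (h1 : (1 : F) ∈ B) (hkl : k ≤ l)
    (hv : IsRepresentable B k v) : IsRepresentable B l v := by
  induction l, hkl using Nat.le_induction with
  | base => exact hv
  | succ l _ ih => simpa using ih.add h0 (isRepresentable_of_mem h1 h0)

theorem IsRepresentable.sub (h0 : (0 : F) ∈ B) (h1 : (1 : F) ∈ B) (hu : IsRepresentable B k u)
    (hv : IsRepresentable B l v) : IsRepresentable B (k + l + 1) (u - v) := by
  rw [sub_eq_add_neg, add_assoc]
  exact hu.add h0 (hv.neg h0 h1)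

/-- Bordering a representation gives a matrix whose entries lie in an affine image of `B`. -/
theorem IsRepresentable.mem_detSet {A : Finset F} {a β γ : F} (hγ : γ ∈ A) (hγ0 : γ ≠ 0)
    (h0 : (0 : F) ∈ B) (hB : ∀ b ∈ B, a + β * b ∈ A) (hv : IsRepresentable B k v) :
    γ * (β ^ (k + 1) * -v) ∈ detSet (k + 2) A := by
  obtain ⟨L, r, c, x, hL, hr, hc, hd, hx, rfl⟩ := hv
  let N : Matrix (Unit ⊕ Fin k) (Unit ⊕ Fin k) F :=
    fromBlocks 0 (replicateRow Unit r) (replicateCol Unit c) L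
  have hN : N.det = -(r ⬝ᵥ x) := by
    have hmul : N * fromBlocks 1 0 (-replicateCol Unit x) 1 =
        fromBlocks (of fun _ _ => -(r ⬝ᵥ x)) (replicateRow Unit r) 0 L := by
      simp only [N, fromBlocks_multiply]
      congr 1
      · ext; simp [Matrix.mul_apply, dotProduct]
      · simp
      · rw [Matrix.mul_neg, ← replicateCol_mulVec, hx]; simp
      · simp
    have := congrArg det hmul
    rw [det_mul, det_fromBlocks_zero₁₂, det_fromBlocks_zero₂₁, det_one, det_one, hd] at this
    simpa using this
  have hNB : ∀ i j, N i j ∈ B := by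
    rintro (i | i) (j | j) <;> simp [N, *]
  have ha : a ∈ A := by simpa using hB 0 h0
  let M : Matrix (Unit ⊕ (Unit ⊕ Fin k)) (Unit ⊕ (Unit ⊕ Fin k)) F :=
    fromBlocks (of fun _ _ => γ) (of fun _ _ => γ) (of fun _ _ => a)
      (of fun i j => a + β * N i j)
  have hMA : ∀ i j, M i j ∈ A := by
    rintro (i | i) (j | j)
    · exact hγ
    · exact hγ
    · exact ha
    · exact hB _ (hNB i j)
  have hM : M.det = γ * (β ^ (k + 1) * -(r ⬝ᵥ x)) := by
    have hmul : M = fromBlocks 1 0 (of fun _ _ => a / γ) 1 *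
        fromBlocks (of fun _ _ => γ) (of fun _ _ => γ) 0 (β • N) := by
      simp only [M, fromBlocks_multiply]
      congr 1
      · simp
      · simp
      · ext; simp [Matrix.mul_apply, hγ0]
      · ext; simp [Matrix.mul_apply, hγ0]
    rw [hmul, det_mul, det_fromBlocks_zero₁₂, det_fromBlocks_zero₂₁, det_smul, hN]
    simp [add_comm]
  let e : Fin (k + 2) ≃ Unit ⊕ (Unit ⊕ Fin k) :=
    (Fintype.equivFinOfCardEq (by simp; omega)).symm
  exact ⟨M.submatrix e e, fun i j => hMA _ _, by rw [det_submatrix_equiv_self, hM]⟩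

end Representable

section Growth

open Finset

variable {F : Type*} [Field F] [Fintype F]

open Classical in
/-- The finite set of elements representable in dimension `k`. -/
noncomputable def repSet (B : Finset F) (k : ℕ) : Finset F :=
  {v | IsRepresentable B k v}

variable {B : Finset F} {k l : ℕ}

theorem mem_repSet {v : F} : v ∈ repSet B k ↔ IsRepresentable B k v := by
  simp [repSet]

theorem repSet_mono (h0 : (0 : F) ∈ B) (h1 : (1 : F) ∈ B) (hkl : k ≤ l) :
    repSet B k ⊆ repSet B l := fun _ hv =>
  mem_repSet.2 ((mem_repSet.1 hv).mono h0 h1 hkl)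


theorem subset_repSet_one (h1 : (1 : F) ∈ B) : B ⊆ repSet B 1 := fun _ hv =>
  mem_repSet.2 (isRepresentable_of_mem h1 hv)

theorem IsDiffQuotient.exists_isRepresentable (h0 : (0 : F) ∈ B) (h1 : (1 : F) ∈ B) {ξ : F}
    (h : IsDiffQuotient (repSet B k) B ξ) :
    ∃ d : F, d ≠ 0 ∧ IsRepresentable B 3 d ∧ IsRepresentable B (2 * k + 1) (d * ξ) := by
  obtain ⟨x₁, hx₁, x₂, hx₂, y₁, hy₁, y₂, hy₂, hne, he⟩ := h
  refine ⟨y₁ - y₂, sub_ne_zero.2 hne,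
    (isRepresentable_of_mem h1 hy₁).sub h0 h1 (isRepresentable_of_mem h1 hy₂), ?_⟩
  rw [mul_comm (y₁ - y₂), he]
  exact ((mem_repSet.1 hx₁).sub h0 h1 (mem_repSet.1 hx₂)).mono h0 h1 (by omega)

variable [DecidableEq F]

theorem card_dilatedSum_repSet_le (h0 : (0 : F) ∈ B) (h1 : (1 : F) ∈ B) {ξ d : F} (hd0 : d ≠ 0)
    (hd : IsRepresentable B 3 d) (hdξ : IsRepresentable B (2 * k + 4) (d * ξ))
    {Y : Finset F} (hY : Y ⊆ repSet B l) (hl : l ≤ k) :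
    #(dilatedSum (repSet B k) Y ξ) ≤ #(repSet B (8 * k + 14)) := by
  refine card_dilatedSum_le_of_mul_mem hd0 fun x hx y hy => mem_repSet.2 ?_
  exact ((hd.mul h0 h1 (mem_repSet.1 hx)).add h0
    (hdξ.mul h0 h1 (mem_repSet.1 (hY hy)))).mono h0 h1 (by omega)

/-- If every field element is a difference quotient, then a larger `repSet` contains a dilate of
a nearly maximal dilated sum of `repSet B k` and `Y`. -/
theorem card_mul_card_le_of_forall_isDiffQuotient (h0 : (0 : F) ∈ B) (h1 : (1 : F) ∈ B)
    (hfull : ∀ ξ, IsDiffQuotient (repSet B k) B ξ) {Y : Finset F} (hY : Y ⊆ repSet B l)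
    (hl : l ≤ k) :
    Fintype.card F * (#(repSet B k) * #Y) ≤
      #(repSet B (8 * k + 14)) * (Fintype.card F + #(repSet B k) * #Y) := by
  obtain ⟨ξ, hξ⟩ := exists_card_dilatedSum_ge (repSet B k) Y
  obtain ⟨d, hd0, hd, hdξ⟩ := (hfull ξ).exists_isRepresentable h0 h1
  exact hξ.trans (Nat.mul_le_mul_right _ (card_dilatedSum_repSet_le h0 h1 hd0 hd
    (hdξ.mono h0 h1 (by omega)) hY hl))

theorem card_mul_card_le_of_not_isDiffQuotient (h0 : (0 : F) ∈ B) (h1 : (1 : F) ∈ B)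
    (hk : 1 ≤ k) {ξ : F} (hξ : IsDiffQuotient (repSet B k) B ξ)
    (hξ' : ¬ IsDiffQuotient (repSet B k) B (ξ + 1)) :
    #(repSet B k) * #B ≤ #(repSet B (8 * k + 14)) := by
  obtain ⟨d, hd0, hd, hdξ⟩ := hξ.exists_isRepresentable h0 h1
  rw [← card_dilatedSum_of_not_isDiffQuotient hξ']
  refine card_dilatedSum_repSet_le h0 h1 hd0 hd ?_ (subset_repSet_one h1) hk
  rw [mul_add, mul_one]
  exact IsRepresentable.add (k := 2 * k + 1) (l := 3) h0 hdξ hd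

theorem exists_isDiffQuotient_not_add_one {p : ℕ} [Fact p.Prime] {X Y : Finset (ZMod p)}
    (hX : X.Nonempty) (hY : 1 < #Y) (h : ¬ ∀ ξ, IsDiffQuotient X Y ξ) :
    ∃ ξ, IsDiffQuotient X Y ξ ∧ ¬ IsDiffQuotient X Y (ξ + 1) := by
  by_contra! hcon
  refine h fun ξ => ?_
  rw [← ZMod.natCast_zmod_val ξ]
  induction ξ.val with
  | zero =>
    obtain ⟨x, hx⟩ := hX
    obtain ⟨a, ha, b, hb, hab⟩ := one_lt_card.1 hY
    exact ⟨x, hx, x, hx, a, ha, b, hb, hab, by simp⟩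
  | succ n ih => simpa using hcon _ ih

theorem card_repSet_growth {p : ℕ} [Fact p.Prime] {B : Finset (ZMod p)}
    (h0 : (0 : ZMod p) ∈ B) (h1 : (1 : ZMod p) ∈ B) {n : ℕ} (hn : 1 ≤ n) :
    #B ^ n ≤ #(repSet B (8 ^ (n + 1) - 2)) ∨
      ((∀ ξ, IsDiffQuotient (repSet B (8 ^ (n + 1) - 2)) B ξ) ∧
        min (#B ^ n) p ≤ 8 * #(repSet B (8 ^ (n + 1) - 2)) ∧
        p ≤ 4 * #(repSet B (8 ^ (n + 1) - 2)) ^ 2) := by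
  have hB : 1 < #B := one_lt_card.2 ⟨0, h0, 1, h1, zero_ne_one⟩
  induction n, hn using Nat.le_induction with
  | base =>
    left
    rw [pow_one]
    exact card_le_card ((subset_repSet_one h1).trans (repSet_mono h0 h1 (by norm_num)))
  | succ n hn ih =>
    obtain ⟨k, hk, hk1⟩ : ∃ k, k = 8 ^ (n + 1) - 2 ∧ 1 ≤ k := by
      refine ⟨_, rfl, ?_⟩
      have : 8 ^ 1 ≤ 8 ^ (n + 1) := Nat.pow_le_pow_right (by norm_num) (by omega)
      omega
    have hk' : 8 ^ (n + 1 + 1) - 2 = 8 * k + 14 := by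
      rw [pow_succ]
      omega
    rw [← hk] at ih
    rw [hk']
    have hsub : repSet B k ⊆ repSet B (8 * k + 14) := repSet_mono h0 h1 (by omega)
    have hBk : B ⊆ repSet B k := (subset_repSet_one h1).trans (repSet_mono h0 h1 hk1)
    by_cases hfull : ∀ ξ, IsDiffQuotient (repSet B k) B ξ
    · have hfull' : ∀ ξ, IsDiffQuotient (repSet B (8 * k + 14)) B ξ := fun ξ =>
        (hfull ξ).mono hsub
      right
      refine ⟨hfull', ?_⟩
      rcases ih with ih | ⟨-, -, ih⟩
      · have hgrow := card_mul_card_le_of_forall_isDiffQuotient h0 h1 hfull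
          (subset_repSet_one h1) hk1
        have hp := card_le_of_forall_isDiffQuotient hfull
        rw [ZMod.card] at hgrow hp
        have hpow : #B ^ (n + 1) ≤ #(repSet B k) * #B := by
          rw [pow_succ]
          exact Nat.mul_le_mul_right _ ih
        generalize #(repSet B k) * #B = t at *
        generalize #(repSet B (8 * k + 14)) = s at *
        have hmin : min t p ≤ 2 * s := by
          rcases le_total t p with h | h
          · rw [min_eq_left h]
            have hp0 : 0 < p := (Fact.out : p.Prime).pos
            nlinarith
          · rw [min_eq_right h]
            have ht0 : 0 < t := (Fact.out : p.Prime).pos.trans_le h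
            nlinarith
        refine ⟨(min_le_min_right p hpow).trans (by omega), ?_⟩
        have hp1 : p ≤ (min t p) ^ 2 := by
          rcases le_total t p with h | h
          · rwa [min_eq_left h]
          · rw [min_eq_right h]
            exact Nat.le_self_pow two_ne_zero p
        calc p ≤ (min t p) ^ 2 := hp1
          _ ≤ (2 * s) ^ 2 := Nat.pow_le_pow_left hmin 2
          _ = 4 * s ^ 2 := by ring
      · have hgrow := card_mul_card_le_of_forall_isDiffQuotient h0 h1 hfull subset_rfl le_rfl
        have hle := card_le_card hsub
        rw [ZMod.card] at hgrow
        generalize #(repSet B k) = t at *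
        generalize #(repSet B (8 * k + 14)) = s at *
        refine ⟨(min_le_right _ _).trans ?_, by nlinarith⟩
        have hp0 : 0 < p := (Fact.out : p.Prime).pos
        have ht0 : 0 < t * t := by nlinarith
        have : p * (t * t) ≤ 5 * s * (t * t) := by nlinarith
        have := le_of_mul_le_mul_right this ht0
        omega
    · rcases ih with ih | ⟨ih, -⟩
      · left
        obtain ⟨ξ, hξ, hξ'⟩ := exists_isDiffQuotient_not_add_one ⟨0, hBk h0⟩ hB hfull
        rw [pow_succ]
        exact (Nat.mul_le_mul_right _ ih).trans
          (card_mul_card_le_of_not_isDiffQuotient h0 h1 hk1 hξ hξ')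
      · exact absurd ih hfull

theorem exists_card_repSet_le_ncard_detSet {A : Finset F} (hA : 1 < #A) :
    ∃ B : Finset F, 0 ∈ B ∧ 1 ∈ B ∧ #B = #A ∧
      ∀ k, #(repSet B k) ≤ (detSet (k + 2) A).ncard := by
  obtain ⟨γ, hγ, hγ0⟩ := exists_mem_ne hA 0
  obtain ⟨a, ha, b, hb, hab⟩ := one_lt_card.1 hA
  have hβ : b - a ≠ 0 := sub_ne_zero.2 hab.symm
  refine ⟨A.image fun x => (x - a) / (b - a), mem_image.2 ⟨a, ha, by simp⟩,
    mem_image.2 ⟨b, hb, div_self hβ⟩, ?_, fun k => ?_⟩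
  · refine card_image_of_injective _ fun x y hxy => ?_
    exact sub_left_injective ((div_left_inj' hβ).1 hxy)
  · rw [← Set.ncard_coe_finset]
    refine Set.ncard_le_ncard_of_injOn (fun v => γ * ((b - a) ^ (k + 1) * -v)) ?_ ?_
      (Set.toFinite _)
    · intro v hv
      refine (mem_repSet.1 (mem_coe.1 hv)).mem_detSet hγ hγ0 (a := a)
        (mem_image.2 ⟨a, ha, by simp⟩) fun y hy => ?_
      obtain ⟨x, hx, rfl⟩ := mem_image.1 hy
      rwa [mul_div_cancel₀ _ hβ, add_sub_cancel]
    · intro v _ w _ hvw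
      exact neg_injective (mul_left_cancel₀ (pow_ne_zero _ hβ) (mul_left_cancel₀ hγ0 hvw))

end Growth

/-- For `A ⊆ 𝔽_p` with `|A| ≥ 2` and every `n ≥ 1`,
`|D_{8^{n+1}}(A)| ≥ (1/8) · min(|A|ⁿ, p)`. -/
theorem card_detSet_pow_ge {p : ℕ} [Fact p.Prime] (A : Finset (ZMod p)) (hA : 2 ≤ A.card) :
    ∀ n : ℕ, 1 ≤ n →
      (1 / 8 : ℝ) * min ((A.card : ℝ) ^ n) (p : ℝ) ≤
        ((detSet (8 ^ (n + 1)) A).ncard : ℝ) := by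
  intro n hn
  obtain ⟨B, h0, h1, hBA, hdet⟩ := exists_card_repSet_le_ncard_detSet hA
  have hle := hdet (8 ^ (n + 1) - 2)
  have h8 : 8 ^ 1 ≤ 8 ^ (n + 1) := Nat.pow_le_pow_right (by norm_num) (by omega)
  rw [Nat.sub_add_cancel (by omega)] at hle
  have hmin : min (A.card ^ n) p ≤ 8 * (detSet (8 ^ (n + 1)) A).ncard := by
    rw [← hBA]
    rcases card_repSet_growth h0 h1 hn with h | ⟨-, h, -⟩
    · exact (min_le_left _ _).trans (by omega)
    · omega
  have hreal : min ((A.card : ℝ) ^ n) (p : ℝ) ≤ 8 * ((detSet (8 ^ (n + 1)) A).ncard : ℝ) := by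
    exact_mod_cast hmin
  linarith
end

section
/- Let p be a prime and let A be a finite subset of the field F_p = Z/pZ with |A| ≥ 2. Then for every natural number n ≥ 1, |D_n(A)| ≥ (1/8) · min(|A|^{(log₂ n)/10}, p), where log₂ denotes the logarithm to base 2. -/
open Matrix

/-- The values `u N⁻¹ v` for `N` an `n × n` matrix of determinant `1`, where all entries of `N`, `u`
and `v` lie in `A`. The vector `w` plays the role of `N⁻¹ v`. -/
def borderSet {F : Type*} [Field F] (n : ℕ) (A : Finset F) : Set F :=
  {x | ∃ (N : Matrix (Fin n) (Fin n) F) (u v w : Fin n → F),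
    (∀ i j, N i j ∈ A) ∧ (∀ i, u i ∈ A) ∧ (∀ i, v i ∈ A) ∧
      N.det = 1 ∧ N *ᵥ w = v ∧ u ⬝ᵥ w = x}

section Field

variable {F : Type*} [Field F] {A : Finset F}

lemma det_mem_detSet {ι : Type*} [Fintype ι] [DecidableEq ι] {n : ℕ}
    (hn : Fintype.card ι = n) (M : Matrix ι ι F) (hM : ∀ i j, M i j ∈ A) :
    M.det ∈ detSet n A := by
  let e := Fintype.equivFinOfCardEq hn
  exact ⟨M.submatrix e.symm e.symm, fun i j => hM _ _, M.det_submatrix_equiv_self e.symm⟩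

lemma dotProduct_mem_borderSet {ι : Type*} [Fintype ι] [DecidableEq ι] {n : ℕ}
    (hn : Fintype.card ι = n) (N : Matrix ι ι F) (u v w : ι → F) (hN : ∀ i j, N i j ∈ A)
    (hu : ∀ i, u i ∈ A) (hv : ∀ i, v i ∈ A) (hdet : N.det = 1) (hw : N *ᵥ w = v) :
    u ⬝ᵥ w ∈ borderSet n A := by
  let e := (Fintype.equivFinOfCardEq hn).symm
  refine ⟨N.submatrix e e, u ∘ e, v ∘ e, w ∘ e, fun i j => hN _ _, fun i => hu _, fun i => hv _,
    ?_, ?_, ?_⟩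
  · rw [det_submatrix_equiv_self, hdet]
  · ext i
    rw [← hw]
    exact Equiv.sum_comp e fun j => N (e i) j * w j
  · exact Equiv.sum_comp e fun j => u j * w j

lemma zero_mem_borderSet (h0 : 0 ∈ A) (h1 : 1 ∈ A) (n : ℕ) : 0 ∈ borderSet n A := by
  refine ⟨1, 0, 0, 0, fun i j => ?_, fun _ => h0, fun _ => h0, det_one, by simp, by simp⟩
  rw [one_apply]
  split_ifs <;> assumption

lemma natCast_mem_borderSet (h0 : 0 ∈ A) (h1 : 1 ∈ A) (n : ℕ) : (n : F) ∈ borderSet n A := by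
  refine ⟨1, 1, 1, 1, fun i j => ?_, fun _ => h1, fun _ => h1, det_one, by simp, by simp⟩
  rw [one_apply]
  split_ifs <;> assumption

lemma mem_borderSet_one (h1 : 1 ∈ A) {a : F} (ha : a ∈ A) : a ∈ borderSet 1 A :=
  ⟨1, fun _ => a, 1, 1, fun i j => by rwa [Subsingleton.elim i j, one_apply_eq],
    fun _ => ha, fun _ => h1, det_one, by simp, by simp [dotProduct]⟩

lemma add_mem_borderSet (h0 : 0 ∈ A) {m n : ℕ} {x y : F} (hx : x ∈ borderSet m A)
    (hy : y ∈ borderSet n A) : x + y ∈ borderSet (m + n) A := by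
  obtain ⟨N, u, v, w, hN, hu, hv, hdet, hw, rfl⟩ := hx
  obtain ⟨N', u', v', w', hN', hu', hv', hdet', hw', rfl⟩ := hy
  have := dotProduct_mem_borderSet (A := A) (n := m + n) (by simp) (fromBlocks N 0 0 N')
    (Sum.elim u u') (Sum.elim v v') (Sum.elim w w')
    (by rintro (i | i) (j | j) <;> simp [*]) (by rintro (i | i) <;> simp [*])
    (by rintro (i | i) <;> simp [*]) (by simp [hdet, hdet'])
    (by simp [fromBlocks_mulVec, hw, hw'])
  simpa using this

lemma borderSet_mono (h0 : 0 ∈ A) (h1 : 1 ∈ A) : Monotone fun n => borderSet n A := by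
  intro m n hmn x hx
  have := add_mem_borderSet h0 hx (zero_mem_borderSet h0 h1 (n - m))
  rwa [add_zero, Nat.add_sub_cancel' hmn] at this

lemma neg_mem_borderSet (h0 : 0 ∈ A) (h1 : 1 ∈ A) {m : ℕ} {x : F} (hx : x ∈ borderSet m A) :
    -x ∈ borderSet (m + 1) A := by
  obtain ⟨N, u, v, w, hN, hu, hv, hdet, hw, rfl⟩ := hx
  have := dotProduct_mem_borderSet (A := A) (n := m + 1) (by simp)
    (fromBlocks N (of fun i (_ : Unit) => v i) 0 1)
    (Sum.elim u 0) (Sum.elim 0 1) (Sum.elim (-w) 1)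
    (by rintro (i | i) (j | j) <;> simp [*]) (by rintro (i | i) <;> simp [*])
    (by rintro (i | i) <;> simp [*]) (by simp [hdet])
    (by
      rw [fromBlocks_mulVec]
      ext (i | i)
      · simp [mulVec_neg, hw, mulVec, dotProduct]
      · simp)
  simpa using this

lemma sub_mem_borderSet (h0 : 0 ∈ A) (h1 : 1 ∈ A) {m n : ℕ} {x y : F}
    (hx : x ∈ borderSet m A) (hy : y ∈ borderSet n A) : x - y ∈ borderSet (m + n + 1) A := by
  simpa [sub_eq_add_neg, add_assoc] using add_mem_borderSet h0 hx (neg_mem_borderSet h0 h1 hy)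

lemma mul_mem_borderSet (h0 : 0 ∈ A) (h1 : 1 ∈ A) {m n : ℕ} {x y : F}
    (hx : x ∈ borderSet m A) (hy : y ∈ borderSet n A) : x * y ∈ borderSet (m + n + 1) A := by
  obtain ⟨N, u, v, w, hN, hu, hv, hdet, hw, rfl⟩ := hx
  obtain ⟨N', u', v', w', hN', hu', hv', hdet', hw', rfl⟩ := hy
  have := dotProduct_mem_borderSet (A := A) (n := m + n + 1) (by simp; omega)
    (fromBlocks N (of fun i (j : Unit ⊕ Fin n) => Sum.elim (fun _ => v i) 0 j) 0
      (fromBlocks 1 (of fun (_ : Unit) j => u' j) 0 N'))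
    (Sum.elim u 0) (Sum.elim 0 (Sum.elim 0 v'))
    (Sum.elim ((u' ⬝ᵥ w') • w) (Sum.elim (fun _ => -(u' ⬝ᵥ w')) w'))
    (by rintro (i | i | i) (j | j | j) <;> simp [*]) (by rintro (i | i | i) <;> simp [*])
    (by rintro (i | i | i) <;> simp [*]) (by simp [hdet, hdet'])
    (by
      rw [fromBlocks_mulVec]
      ext (i | i | i)
      · simp [mulVec_smul, hw, mulVec, dotProduct, mul_comm]
      · simp [fromBlocks_mulVec, mulVec, dotProduct]
      · simp [fromBlocks_mulVec, hw'])
  simpa [mul_comm] using this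

lemma neg_mem_detSet_of_mem_borderSet (h0 : 0 ∈ A) {m : ℕ} {x : F} (hx : x ∈ borderSet m A) :
    -x ∈ detSet (m + 1) A := by
  obtain ⟨N, u, v, w, hN, hu, hv, hdet, hw, rfl⟩ := hx
  have hunit : IsUnit N.det := by simp [hdet]
  let _ : Invertible N := N.invertibleOfIsUnitDet hunit
  have := det_mem_detSet (A := A) (n := m + 1) (by simp; omega)
    (fromBlocks 0 (of fun (_ : Unit) j => u j) (of fun i (_ : Unit) => v i) N)
    (by rintro (i | i) (j | j) <;> simp [*])
  rw [det_fromBlocks₂₂, hdet] at this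
  convert this using 1
  have hinv : N⁻¹ *ᵥ v = w := by rw [← hw, mulVec_mulVec, nonsing_inv_mul _ hunit, one_mulVec]
  rw [invOf_eq_nonsing_inv, Matrix.mul_assoc, ← hinv]
  simp [det_unique, mul_apply, dotProduct, mulVec]

/-- Bordering by a row and a column of `a`'s passes from `(A - a) / (b - a)` to `A`. -/
lemma mul_mem_detSet_succ {B : Finset F} {a c : F} (ha : a ∈ A) (ha0 : a ≠ 0)
    (hB : ∀ x ∈ B, a + c * x ∈ A) {n : ℕ} {x : F} (hx : x ∈ detSet n B) :
    a * c ^ n * x ∈ detSet (n + 1) A := by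
  obtain ⟨K, hK, rfl⟩ := hx
  let D : Matrix Unit Unit F := of fun _ _ => a
  have hD : IsUnit D.det := by simpa [D] using ha0
  let _ : Invertible D := D.invertibleOfIsUnitDet hD
  have := det_mem_detSet (A := A) (n := n + 1) (by simp; omega)
    (fromBlocks D (of fun _ _ => a) (of fun _ _ => a) (of fun i j => a + c * K i j))
    (by rintro (i | i) (j | j) <;> simp [D, ha, hB _ (hK _ _)])
  rw [det_fromBlocks₁₁] at this
  convert this using 1
  have : (of fun i j => a + c * K i j) -
      (of fun _ _ => a : Matrix (Fin n) Unit F) * ⅟D * (of fun _ _ => a : Matrix Unit (Fin n) F)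
      = c • K := by
    ext i j
    simp [mul_apply, D, invOf_eq_nonsing_inv, ha0]
  rw [this, det_smul]
  simp [D, mul_assoc]

end Field

section Growth

open Finset

/-- Cauchy–Schwarz for the number of collisions of a map. -/
lemma sq_card_le_card_image_mul_collisions {α β : Type*} [DecidableEq β] (S : Finset α)
    (f : α → β) :
    #S ^ 2 ≤ #(S.image f) * #{st ∈ S ×ˢ S | f st.1 = f st.2} := by
  have h1 : #S = ∑ b ∈ S.image f, #{s ∈ S | f s = b} :=
    card_eq_sum_card_fiberwise fun s hs => mem_image_of_mem f hs
  have h2 : #{st ∈ S ×ˢ S | f st.1 = f st.2} = ∑ b ∈ S.image f, #{s ∈ S | f s = b} ^ 2 := by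
    rw [card_eq_sum_card_fiberwise (f := fun st : α × α => f st.1) (t := S.image f)]
    · refine sum_congr rfl fun b _ => ?_
      rw [sq, ← card_product]
      congr 1
      ext ⟨s, t⟩
      simp only [mem_filter, mem_product]
      constructor
      · rintro ⟨⟨⟨hs, ht⟩, h⟩, rfl⟩
        exact ⟨⟨hs, rfl⟩, ht, h.symm⟩
      · rintro ⟨⟨hs, rfl⟩, ht, h⟩
        exact ⟨⟨⟨hs, ht⟩, h.symm⟩, rfl⟩
    · rintro ⟨s, t⟩ h
      simp only [coe_filter, mem_product, Set.mem_ofPred_eq] at h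
      exact mem_image_of_mem f h.1.1
  rw [h2, h1]
  exact sq_sum_le_card_mul_sum_sq

variable {F : Type*} [Field F] [DecidableEq F]

/-- Some dilate `ξ` makes `X + ξX` as large as a constant times `min (|X|²) |F|`. -/
lemma exists_min_sq_card_le_card_image_add_mul [Fintype F] (X : Finset F) :
    ∃ ξ : F, min (#X ^ 2) (Fintype.card F) ≤
      2 * #((X ×ˢ X).image fun z => z.1 + ξ * z.2) := by
  set q := Fintype.card F
  set E : F → ℕ := fun ξ =>
    #{st ∈ (X ×ˢ X) ×ˢ (X ×ˢ X) | st.1.1 + ξ * st.1.2 = st.2.1 + ξ * st.2.2} with hE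
  have hsum : ∑ ξ, E ξ ≤ #X ^ 2 * q + #X ^ 4 := by
    have hcount : ∑ ξ, E ξ = ∑ st ∈ (X ×ˢ X) ×ˢ (X ×ˢ X),
        #{ξ : F | st.1.1 + ξ * st.1.2 = st.2.1 + ξ * st.2.2} := by
      simp only [hE, card_filter]
      exact sum_comm
    have hle : ∀ st ∈ (X ×ˢ X) ×ˢ (X ×ˢ X),
        #{ξ : F | st.1.1 + ξ * st.1.2 = st.2.1 + ξ * st.2.2} ≤
          (if st.1 = st.2 then q else 0) + 1 := by
      rintro ⟨⟨x, y⟩, x', y'⟩ -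
      dsimp only
      split_ifs with h
      · exact (card_le_univ _).trans (Nat.le_succ _)
      · rw [zero_add, card_le_one]
        intro ξ hξ η hη
        simp only [mem_filter, mem_univ, true_and] at hξ hη
        have hprod : (ξ - η) * (y - y') = 0 := by linear_combination hξ - hη
        rcases mul_eq_zero.1 hprod with h' | h'
        · exact sub_eq_zero.1 h'
        · have hy := sub_eq_zero.1 h'
          subst hy
          exact absurd (by simpa using hξ) h
    rw [hcount]
    refine (sum_le_sum hle).trans ?_
    rw [sum_add_distrib, sum_product]
    simp only [sum_ite_eq, sum_const, card_product, smul_eq_mul, mul_one]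
    rw [sum_congr rfl fun z hz => if_pos hz]
    simp only [sum_const, card_product, smul_eq_mul]
    exact le_of_eq (by ring)
  obtain ⟨ξ, -, hξ⟩ : ∃ ξ ∈ (univ : Finset F), q * E ξ ≤ #X ^ 2 * q + #X ^ 4 := by
    by_contra! h
    have := sum_lt_sum_of_nonempty univ_nonempty h
    rw [← mul_sum, sum_const, card_univ, smul_eq_mul] at this
    exact absurd (Nat.mul_le_mul_left q hsum) (not_le.2 this)
  refine ⟨ξ, ?_⟩
  have hcs := sq_card_le_card_image_mul_collisions (X ×ˢ X) fun z => z.1 + ξ * z.2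
  rw [card_product] at hcs
  change _ ≤ _ * E ξ at hcs
  set I := #((X ×ˢ X).image fun z => z.1 + ξ * z.2)
  rcases X.eq_empty_or_nonempty with rfl | hX
  · simp
  have hpos : 0 < #X ^ 2 := by have := hX.card_pos; positivity
  have hkey : #X ^ 2 * q ≤ I * (q + #X ^ 2) := by
    refine Nat.le_of_mul_le_mul_left ?_ hpos
    calc #X ^ 2 * (#X ^ 2 * q) = q * (#X * #X) ^ 2 := by ring
      _ ≤ q * (I * E ξ) := Nat.mul_le_mul_left q hcs
      _ = I * (q * E ξ) := by ring
      _ ≤ I * (#X ^ 2 * q + #X ^ 4) := Nat.mul_le_mul_left I hξ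
      _ = #X ^ 2 * (I * (q + #X ^ 2)) := by ring
  have hq : 0 < q := Fintype.card_pos
  rcases le_total (#X ^ 2) q with h | h
  · rw [min_eq_left h]
    refine Nat.le_of_mul_le_mul_right (c := q) ?_ hq
    nlinarith [Nat.mul_le_mul_left I h]
  · rw [min_eq_right h]
    refine Nat.le_of_mul_le_mul_right (c := #X ^ 2) ?_ hpos
    nlinarith [Nat.mul_le_mul_left I h]

lemma card_image_add_mul_eq_sq (X : Finset F) (ξ : F)
    (hξ : ∀ a ∈ X, ∀ b ∈ X, ∀ c ∈ X, ∀ d ∈ X, c ≠ d → ξ * (c - d) ≠ a - b) :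
    #((X ×ˢ X).image fun z => z.1 + ξ * z.2) = #X ^ 2 := by
  rw [card_image_of_injOn, card_product, sq]
  rintro ⟨x, y⟩ h ⟨x', y'⟩ h' heq
  simp only [coe_product, Set.mem_prod, mem_coe] at h h' heq
  have hy : y = y' := by
    by_contra hne
    exact hξ x' h'.1 x h.1 y h.2 y' h'.2 hne (by linear_combination heq)
  subst hy
  simpa using heq

lemma exists_min_sq_card_le_card_image {p : ℕ} [Fact p.Prime] (X : Finset (ZMod p))
    (hX : 2 ≤ #X) :
    ∃ a ∈ X, ∃ b ∈ X, ∃ c ∈ X, ∃ d ∈ X, min (#X ^ 2) p ≤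
      2 * #((X ×ˢ X).image fun z => (c - d) * (z.1 + z.2) + (a - b) * z.2) := by
  suffices ∃ a ∈ X, ∃ b ∈ X, ∃ c ∈ X, ∃ d ∈ X, ∃ ξ : ZMod p, c ≠ d ∧
      ξ * (c - d) = a - b ∧
      min (#X ^ 2) p ≤ 2 * #((X ×ˢ X).image fun z => z.1 + (ξ + 1) * z.2) by
    obtain ⟨a, ha, b, hb, c, hc, d, hd, ξ, hcd, hξ, h⟩ := this
    refine ⟨a, ha, b, hb, c, hc, d, hd, h.trans (Nat.mul_le_mul_left 2 ?_)⟩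
    have : (X ×ˢ X).image (fun z => (c - d) * (z.1 + z.2) + (a - b) * z.2) =
        ((X ×ˢ X).image fun z => z.1 + (ξ + 1) * z.2).image fun t => (c - d) * t := by
      rw [image_image]
      refine image_congr fun z _ => ?_
      simp only [Function.comp, ← hξ]
      ring
    rw [this, card_image_of_injective _ (mul_right_injective₀ (sub_ne_zero.2 hcd))]
  by_cases hR : ∀ ξ : ZMod p, (∃ a ∈ X, ∃ b ∈ X, ∃ c ∈ X, ∃ d ∈ X, c ≠ d ∧ ξ * (c - d) = a - b) →
      ∃ a ∈ X, ∃ b ∈ X, ∃ c ∈ X, ∃ d ∈ X, c ≠ d ∧ (ξ + 1) * (c - d) = a - b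
  · have hall (n : ℕ) : ∃ a ∈ X, ∃ b ∈ X, ∃ c ∈ X, ∃ d ∈ X, c ≠ d ∧
        (n : ZMod p) * (c - d) = a - b := by
      induction n with
      | zero =>
        obtain ⟨c, hc, d, hd, hcd⟩ := one_lt_card.1 hX
        exact ⟨c, hc, c, hc, c, hc, d, hd, hcd, by simp⟩
      | succ n ih => simpa using hR n ih
    obtain ⟨ξ, hξ⟩ := exists_min_sq_card_le_card_image_add_mul X
    rw [ZMod.card] at hξ
    obtain ⟨a, ha, b, hb, c, hc, d, hd, hcd, h⟩ := hall (ξ - 1).val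
    rw [ZMod.natCast_zmod_val] at h
    exact ⟨a, ha, b, hb, c, hc, d, hd, ξ - 1, hcd, h, by simpa using hξ⟩
  · push Not at hR
    obtain ⟨ξ, ⟨a, ha, b, hb, c, hc, d, hd, hcd, h⟩, hξ⟩ := hR
    refine ⟨a, ha, b, hb, c, hc, d, hd, ξ, hcd, h, ?_⟩
    rw [card_image_add_mul_eq_sq X (ξ + 1) hξ]
    exact (min_le_left _ _).trans (Nat.le_mul_of_pos_left _ two_pos)

end Growth

section PrimeField

variable {p : ℕ} [Fact p.Prime] {A : Finset (ZMod p)}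

lemma ncard_borderSet_mono (h0 : 0 ∈ A) (h1 : 1 ∈ A) :
    Monotone fun n => (borderSet n A).ncard := fun _ _ hmn =>
  Set.ncard_le_ncard (borderSet_mono h0 h1 hmn)

lemma card_le_ncard_borderSet (h0 : 0 ∈ A) (h1 : 1 ∈ A) {n : ℕ} (hn : 1 ≤ n) :
    A.card ≤ (borderSet n A).ncard := by
  rw [← Set.ncard_coe_finset]
  exact Set.ncard_le_ncard fun a ha => borderSet_mono h0 h1 hn (mem_borderSet_one h1 ha)

lemma min_le_ncard_borderSet (h0 : 0 ∈ A) (h1 : 1 ∈ A) (n : ℕ) :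
    min n p ≤ (borderSet n A).ncard := by
  have hinj : Set.InjOn (fun k : ℕ => (k : ZMod p)) (Finset.range (min n p)) := by
    intro i hi j hj h
    simp only [Finset.coe_range, Set.mem_Iio, lt_min_iff] at hi hj
    exact Nat.ModEq.eq_of_lt_of_lt ((ZMod.natCast_eq_natCast_iff _ _ _).1 h) hi.2 hj.2
  rw [← Finset.card_range (min n p), ← Finset.card_image_of_injOn hinj, ← Set.ncard_coe_finset]
  refine Set.ncard_le_ncard fun x hx => ?_
  obtain ⟨k, hk, rfl⟩ := Finset.mem_image.1 (Finset.mem_coe.1 hx)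
  have hkn := (lt_min_iff.1 (Finset.mem_range.1 hk)).1
  exact borderSet_mono h0 h1 hkn.le (natCast_mem_borderSet h0 h1 k)

lemma min_sq_ncard_borderSet_le (h0 : 0 ∈ A) (h1 : 1 ∈ A) {m : ℕ} (hm : 4 ≤ m) :
    min ((borderSet m A).ncard ^ 2) p ≤ 2 * (borderSet (8 * m) A).ncard := by
  classical
  set X := (borderSet m A).toFinset with hX
  have hmem {x : ZMod p} : x ∈ X ↔ x ∈ borderSet m A := Set.mem_toFinset
  have hcard : (borderSet m A).ncard = X.card := Set.ncard_eq_toFinset_card' _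
  have hX2 : 2 ≤ X.card := by
    rw [← hcard]
    exact (le_min (by omega) (Fact.out : p.Prime).two_le).trans (min_le_ncard_borderSet h0 h1 m)
  obtain ⟨a, ha, b, hb, c, hc, d, hd, h⟩ := exists_min_sq_card_le_card_image X hX2
  rw [hcard]
  refine h.trans (Nat.mul_le_mul_left 2 ?_)
  rw [← Set.ncard_coe_finset]
  refine Set.ncard_le_ncard fun t ht => ?_
  obtain ⟨⟨x, y⟩, hxy, rfl⟩ := Finset.mem_image.1 (Finset.mem_coe.1 ht)
  rw [Finset.mem_product] at hxy
  simp only [hmem] at ha hb hc hd hxy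
  refine borderSet_mono h0 h1 (by omega) (add_mem_borderSet h0
    (mul_mem_borderSet h0 h1 (sub_mem_borderSet h0 h1 hc hd) (add_mem_borderSet h0 hxy.1 hxy.2))
    (mul_mem_borderSet h0 h1 (sub_mem_borderSet h0 h1 ha hb) hxy.2))

lemma min_card_pow_le_ncard_borderSet (hp : 4 ≤ p) (h0 : 0 ∈ A) (h1 : 1 ∈ A) (j : ℕ) :
    min (4 * A.card ^ 2 ^ j) p ≤ 2 * (borderSet (8 ^ (j + 2)) A).ncard := by
  induction j with
  | zero =>
    refine le_trans ?_ (min_sq_ncard_borderSet_le h0 h1 (m := 8) (by norm_num))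
    have hk := card_le_ncard_borderSet h0 h1 (n := 8) (by norm_num)
    have hmin := min_le_ncard_borderSet h0 h1 8
    refine le_min ?_ (min_le_right _ _)
    rcases min_le_iff.1 hmin with h | h
    · refine (min_le_left _ _).trans ?_
      rw [pow_zero, pow_one]
      nlinarith
    · refine (min_le_right _ _).trans ?_
      nlinarith
  | succ j ih =>
    have hm : 4 ≤ 8 ^ (j + 2) := by
      calc 4 ≤ 8 ^ 1 := by norm_num
        _ ≤ 8 ^ (j + 2) := Nat.pow_le_pow_right (by norm_num) (by omega)
    have hstep := min_sq_ncard_borderSet_le h0 h1 hm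
    rw [← pow_succ'] at hstep
    refine le_trans (le_min ?_ (min_le_right _ _)) hstep
    rcases min_le_iff.1 ih with h | h
    · refine (min_le_left _ _).trans ?_
      rw [pow_succ 2 j, pow_mul]
      calc 4 * (A.card ^ 2 ^ j) ^ 2 = (2 * A.card ^ 2 ^ j) ^ 2 := by ring
        _ ≤ _ := Nat.pow_le_pow_left (by omega) 2
    · refine (min_le_right _ _).trans ?_
      nlinarith

lemma ncard_borderSet_le_ncard_detSet (h0 : 0 ∈ A) (m : ℕ) :
    (borderSet m A).ncard ≤ (detSet (m + 1) A).ncard :=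
  Set.ncard_le_ncard_of_injOn _ (fun _ hx => neg_mem_detSet_of_mem_borderSet h0 hx)
    neg_injective.injOn

lemma ncard_detSet_one (A : Finset (ZMod p)) : (detSet 1 A).ncard = A.card := by
  rw [← Set.ncard_coe_finset]
  congr 1
  ext x
  constructor
  · rintro ⟨M, hM, rfl⟩
    simpa using hM 0 0
  · exact fun hx => ⟨of fun _ _ => x, fun _ _ => hx, by simp⟩

lemma card_le_ncard_detSet (h0 : 0 ∈ A) (h1 : 1 ∈ A) {n : ℕ} (hn : 1 ≤ n) :
    A.card ≤ (detSet n A).ncard := by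
  obtain rfl | ⟨m, rfl, hm⟩ : n = 1 ∨ ∃ m, n = m + 1 ∧ 1 ≤ m := by
    by_cases h : n = 1
    · exact .inl h
    · exact .inr ⟨n - 1, by omega, by omega⟩
  · exact (ncard_detSet_one A).ge
  · exact (card_le_ncard_borderSet h0 h1 hm).trans (ncard_borderSet_le_ncard_detSet h0 m)

/-- At the cost of one dimension, `A` can be normalised to contain `0` and `1`. -/
lemma exists_normalization (hA : 2 ≤ A.card) :
    ∃ B : Finset (ZMod p), B.card = A.card ∧ 0 ∈ B ∧ 1 ∈ B ∧
      ∀ n, (detSet n B).ncard ≤ (detSet (n + 1) A).ncard := by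
  classical
  obtain ⟨a, ha, ha0⟩ := Finset.exists_mem_ne hA 0
  obtain ⟨b, hb, hba⟩ := Finset.exists_mem_ne hA a
  have hc : b - a ≠ 0 := sub_ne_zero.2 hba
  have hinj : Function.Injective fun x => (b - a)⁻¹ * (x - a) :=
    (mul_right_injective₀ (inv_ne_zero hc)).comp sub_left_injective
  refine ⟨A.image fun x => (b - a)⁻¹ * (x - a), Finset.card_image_of_injective _ hinj,
    Finset.mem_image.2 ⟨a, ha, by simp⟩, Finset.mem_image.2 ⟨b, hb, inv_mul_cancel₀ hc⟩,
    fun n => Set.ncard_le_ncard_of_injOn _ (fun x hx => mul_mem_detSet_succ ha ha0 ?_ hx)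
      (mul_right_injective₀ (mul_ne_zero ha0 (pow_ne_zero n hc))).injOn⟩
  intro y hy
  obtain ⟨x, hx, rfl⟩ := Finset.mem_image.1 hy
  rwa [mul_inv_cancel_left₀ hc, add_sub_cancel]

lemma card_le_ncard_detSet_of_two_le_card (hA : 2 ≤ A.card) {n : ℕ} (hn : 1 ≤ n) :
    A.card ≤ (detSet n A).ncard := by
  obtain ⟨B, hBA, h0, h1, hB⟩ := exists_normalization hA
  obtain _ | _ | m := n
  · omega
  · exact (ncard_detSet_one A).ge
  · rw [← hBA]
    exact (card_le_ncard_detSet h0 h1 (by omega)).trans (hB (m + 1))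

lemma min_card_pow_le_ncard_detSet (hp : 4 ≤ p) (hA : 2 ≤ A.card) {n j : ℕ}
    (hn : 8 ^ (j + 2) + 2 ≤ n) :
    min (4 * A.card ^ 2 ^ j) p ≤ 2 * (detSet n A).ncard := by
  obtain ⟨B, hBA, h0, h1, hB⟩ := exists_normalization hA
  obtain ⟨m, rfl⟩ := Nat.exists_eq_add_of_le' ((Nat.le_add_left 2 _).trans hn)
  rw [← hBA]
  refine (min_card_pow_le_ncard_borderSet hp h0 h1 j).trans (Nat.mul_le_mul_left 2 ?_)
  exact (ncard_borderSet_mono h0 h1 (by omega)).trans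
    ((ncard_borderSet_le_ncard_detSet h0 m).trans (hB (m + 1)))

end PrimeField

lemma rpow_logb_div_le_pow {k : ℝ} (hk : 1 ≤ k) {n e t : ℕ} (hn : 1 ≤ n) (hne : n ≤ 2 ^ e)
    (het : e ≤ 10 * t) : k ^ (Real.logb 2 n / 10) ≤ k ^ t := by
  rw [← Real.rpow_natCast k t]
  refine Real.rpow_le_rpow_of_exponent_le hk ?_
  have hlog : Real.logb 2 n ≤ e := by
    rw [Real.logb_le_iff_le_rpow (by norm_num) (by exact_mod_cast hn), Real.rpow_natCast]
    exact_mod_cast hne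
  have : (e : ℝ) ≤ 10 * t := by exact_mod_cast het
  linarith

/-- For `A ⊆ 𝔽_p` with `|A| ≥ 2` and every `n ≥ 1`,
`|D_n(A)| ≥ (1/8) · min(|A|^{(log₂ n)/10}, p)`. -/
theorem card_detSet_ge_rpow_logb {p : ℕ} [Fact p.Prime] (A : Finset (ZMod p))
    (hA : 2 ≤ A.card) :
    ∀ n : ℕ, 1 ≤ n →
      (1 / 8 : ℝ) * min ((A.card : ℝ) ^ (Real.logb 2 n / 10)) (p : ℝ) ≤
        ((detSet n A).ncard : ℝ) := by
  intro n hn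
  have hk : (1 : ℝ) ≤ A.card := by exact_mod_cast one_le_two.trans hA
  have hcard : (A.card : ℝ) ≤ (detSet n A).ncard := by
    exact_mod_cast card_le_ncard_detSet_of_two_le_card hA hn
  rcases le_or_gt n (2 ^ 10) with hsmall | hlarge
  · have := rpow_logb_div_le_pow hk (t := 1) hn hsmall (by norm_num)
    have := (min_le_left ((A.card : ℝ) ^ (Real.logb 2 n / 10)) (p : ℝ)).trans this
    linarith
  rcases lt_or_ge p 4 with hp | hp
  · have := min_le_right ((A.card : ℝ) ^ (Real.logb 2 n / 10)) (p : ℝ)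
    have : (p : ℝ) < 4 := by exact_mod_cast hp
    linarith
  have hlog : 3 ≤ Nat.log 8 (n - 2) := Nat.le_log_of_pow_le (by norm_num) (by omega)
  obtain ⟨j, hj⟩ := Nat.exists_eq_add_of_le' (show 2 ≤ Nat.log 8 (n - 2) by omega)
  have hlower : 8 ^ (j + 2) ≤ n - 2 := hj ▸ Nat.pow_log_le_self 8 (by omega)
  have hupper : n - 2 < 8 ^ (j + 3) := by
    simpa [hj] using Nat.lt_pow_succ_log_self (b := 8) (by norm_num) (n - 2)
  have hn_le : n ≤ 2 ^ (3 * j + 10) := by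
    have : 2 ^ (3 * j + 10) = 2 * 8 ^ (j + 3) := by
      rw [show 3 * j + 10 = 3 * (j + 3) + 1 by ring, pow_succ, pow_mul]
      norm_num [mul_comm]
    omega
  have hexp : 3 * j + 10 ≤ 10 * 2 ^ j := by
    have := Nat.lt_two_pow_self (n := j)
    omega
  have hpow := rpow_logb_div_le_pow hk hn hn_le hexp
  have hmain : min (4 * (A.card : ℝ) ^ 2 ^ j) (p : ℝ) ≤ 2 * (detSet n A).ncard := by
    exact_mod_cast min_card_pow_le_ncard_detSet hp hA (show 8 ^ (j + 2) + 2 ≤ n by omega)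
  have hpos : (0 : ℝ) < (A.card : ℝ) ^ 2 ^ j := by positivity
  have : min ((A.card : ℝ) ^ (Real.logb 2 n / 10)) (p : ℝ) ≤ min (4 * (A.card : ℝ) ^ 2 ^ j) (p : ℝ) :=
    min_le_min_right _ (by linarith)
  have : (0 : ℝ) ≤ (detSet n A).ncard := Nat.cast_nonneg _
  linarith
end

section
/- Let F be a field, m ≥ 1, n ≥ 2, and let a_{i,j} ∈ F for 1 ≤ i ≤ m, 1 ≤ j ≤ n. Let 𝓜(a) be the (m(n−1)+1) × (m(n−1)+1) matrix from the construction of Theorem 1: its first row has entry a_{i,n} in the column corresponding to the first column of the i-th diagonal block and zeros elsewhere; its first column has entry a_{i,1} in the row corresponding to the last row of the i-th diagonal block and zeros elsewhere; its i-th diagonal block is the (n−1) × (n−1) matrix with 1 on the diagonal and superdiagonal entries a_{i,n−1}, …, a_{i,2}; all other entries are 0. Then the permanent of 𝓜(a), defined as per(M) = Σ_{σ ∈ S_k} Π_{i} M(i, σ(i)), satisfies per(𝓜(a)) = Σ_{i=1}^{m} Π_{j=1}^{n} a_{i,j}; in particular per(𝓜(a)) = (−1)^{n+1} det(𝓜(a)).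 -/
/-- The permanent of a `k × k` matrix: `per M = ∑_{σ ∈ S_k} ∏_i M (i, σ i)`. -/
def permanent {F : Type*} [Field F] {k : ℕ} (M : Matrix (Fin k) (Fin k) F) : F :=
  ∑ σ : Equiv.Perm (Fin k), ∏ i, M i (σ i)

/-- The index in `𝓜(a)` of the `t`-th vertex on the cycle through the `i`-th block: `0` for
`t = 0`, and the position `t - 1` of block `i` otherwise. -/
def calMIndex {m k : ℕ} (i : Fin m) (t : Fin (k + 2)) : Fin (m * (k + 2 - 1) + 1) :=
  ⟨if (t : ℕ) = 0 then 0 else i * (k + 1) + t, by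
    have h : ((i : ℕ) + 1) * (k + 1) ≤ m * (k + 1) := Nat.mul_le_mul_right _ i.2
    have ht := t.2
    show _ < m * (k + 1) + 1
    split_ifs
    · omega
    · rw [add_mul] at h
      omega⟩

theorem calMIndex_zero {m k : ℕ} (i : Fin m) : calMIndex i (0 : Fin (k + 2)) = 0 := by
  simp [calMIndex]

theorem val_calMIndex_of_ne_zero {m k : ℕ} (i : Fin m) {t : Fin (k + 2)} (ht : t ≠ 0) :
    (calMIndex i t : ℕ) = i * (k + 1) + (t - 1) + 1 := by
  have h : (t : ℕ) ≠ 0 := fun h => ht (Fin.ext h)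
  simp only [calMIndex, if_neg h]
  omega

theorem calMIndex_div {m k : ℕ} (i : Fin m) {t : Fin (k + 2)} (ht : t ≠ 0) :
    ((calMIndex i t : ℕ) - 1) / (k + 1) = i := by
  have h := t.2
  rw [val_calMIndex_of_ne_zero i ht, Nat.add_sub_cancel, mul_comm, Nat.mul_add_div (by omega),
    Nat.div_eq_of_lt (by omega), add_zero]

theorem calMIndex_mod {m k : ℕ} (i : Fin m) {t : Fin (k + 2)} (ht : t ≠ 0) :
    ((calMIndex i t : ℕ) - 1) % (k + 1) = t - 1 := by
  have h := t.2
  rw [val_calMIndex_of_ne_zero i ht, Nat.add_sub_cancel, mul_comm, Nat.mul_add_mod,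
    Nat.mod_eq_of_lt (by omega)]

theorem calMIndex_ne_zero {m k : ℕ} (i : Fin m) {t : Fin (k + 2)} (ht : t ≠ 0) :
    (calMIndex i t : ℕ) ≠ 0 := by
  rw [val_calMIndex_of_ne_zero i ht]
  omega

theorem eq_of_calMIndex_eq {m k : ℕ} {i l : Fin m} {t s : Fin (k + 2)}
    (h : calMIndex i t = calMIndex l s) : t = s ∧ (t ≠ 0 → i = l) := by
  by_cases ht : t = 0
  · subst ht
    by_cases hs : s = 0
    · simp [hs]
    · rw [calMIndex_zero] at h
      exact absurd (by rw [← h]; rfl) (calMIndex_ne_zero l hs)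
  · by_cases hs : s = 0
    · subst hs
      rw [calMIndex_zero] at h
      exact absurd (by rw [h]; rfl) (calMIndex_ne_zero i ht)
    · have hm := calMIndex_mod i ht
      have hd := calMIndex_div i ht
      rw [h, calMIndex_mod l hs] at hm
      rw [h, calMIndex_div l hs] at hd
      have h1 : (t : ℕ) ≠ 0 := fun h => ht (Fin.ext h)
      have h2 : (s : ℕ) ≠ 0 := fun h => hs (Fin.ext h)
      exact ⟨Fin.ext (by omega), fun _ => Fin.ext hd.symm⟩

theorem calMIndex_injective {m k : ℕ} (i : Fin m) :
    Function.Injective (calMIndex i : Fin (k + 2) → _) :=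
  fun _ _ h => (eq_of_calMIndex_eq h).1

theorem exists_calMIndex_eq {m k : ℕ} {p : Fin (m * (k + 2 - 1) + 1)} (hp : p ≠ 0) :
    ∃ (i : Fin m) (t : Fin (k + 2)), t ≠ 0 ∧ calMIndex i t = p := by
  have hp0 : (p : ℕ) ≠ 0 := fun h => hp (Fin.ext h)
  have hlt : (p : ℕ) < m * (k + 1) + 1 := p.2
  have hmod : ((p : ℕ) - 1) % (k + 1) < k + 1 := Nat.mod_lt _ (by omega)
  have hdm := Nat.div_add_mod ((p : ℕ) - 1) (k + 1)
  have ht : (⟨((p : ℕ) - 1) % (k + 1) + 1, by omega⟩ : Fin (k + 2)) ≠ 0 :=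
    fun h => by simpa using congrArg Fin.val h
  refine ⟨⟨((p : ℕ) - 1) / (k + 1), (Nat.div_lt_iff_lt_mul (by omega)).2 (by omega)⟩, _, ht, ?_⟩
  apply Fin.ext
  rw [val_calMIndex_of_ne_zero _ ht]
  simp only [Nat.add_sub_cancel]
  rw [mul_comm]
  omega

section Entries

variable {F : Type*} [Field F] {m k : ℕ} (a : Fin m → Fin (k + 2) → F)

theorem calM_apply_self {p : Fin (m * (k + 2 - 1) + 1)} (hp : p ≠ 0) :
    calM m (k + 2) a p p = 1 := by
  have hp0 : (p : ℕ) ≠ 0 := fun h => hp (Fin.ext h)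
  simp only [calM, Matrix.of_apply, if_neg hp0, if_true]

theorem calM_apply_succ (i : Fin m) (t : Fin (k + 2)) :
    calM m (k + 2) a (calMIndex i t) (calMIndex i (t + 1)) = a i t.rev := by
  have hk : k + 2 - 1 = k + 1 := rfl
  have hv := Fin.val_add_one t
  by_cases hl : t = Fin.last (k + 1)
  · subst hl
    have ht : Fin.last (k + 1) ≠ 0 := Fin.last_pos.ne'
    rw [Fin.last_add_one, calMIndex_zero]
    simp only [calM, Matrix.of_apply, if_neg (calMIndex_ne_zero i ht), hk, calMIndex_mod i ht,
      calMIndex_div i ht]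
    simp
  · rw [if_neg hl] at hv
    have ht1 : t + 1 ≠ 0 := fun h => by simp [h] at hv
    by_cases ht : t = 0
    · subst ht
      rw [calMIndex_zero]
      simp only [calM, Matrix.of_apply, if_neg (calMIndex_ne_zero i ht1), hk,
        calMIndex_mod i ht1, calMIndex_div i ht1, hv]
      simp [Fin.last]
    · have h1 : (t : ℕ) ≠ 0 := fun h => ht (Fin.ext h)
      simp only [calM, Matrix.of_apply, if_neg (calMIndex_ne_zero i ht1),
        if_neg (calMIndex_ne_zero i ht), hk,
        calMIndex_mod i ht1, calMIndex_div i ht1, calMIndex_mod i ht, calMIndex_div i ht, hv]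
      rw [if_pos trivial, if_neg (by omega), if_pos (by omega), dif_pos ⟨i.2, by omega⟩]
      congr 1
      apply Fin.ext
      simp only [Fin.val_rev]
      omega

theorem calM_apply_ne_zero {p q : Fin (m * (k + 2 - 1) + 1)}
    (h : calM m (k + 2) a p q ≠ 0) :
    (∃ (i : Fin m) (t : Fin (k + 2)), p = calMIndex i t ∧ q = calMIndex i (t + 1)) ∨
      (p = q ∧ p ≠ 0) := by
  have hk : k + 2 - 1 = k + 1 := rfl
  have hk' : k + 2 - 2 = k := rfl
  by_cases hp : p = 0
  · by_cases hq : q = 0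
    · simp [calM, hp, hq] at h
    · obtain ⟨i, t, ht, rfl⟩ := exists_calMIndex_eq hq
      have ht0 : (t : ℕ) ≠ 0 := fun h => ht (Fin.ext h)
      subst hp
      simp only [calM, Matrix.of_apply, if_neg (calMIndex_ne_zero i ht), hk,
        calMIndex_mod i ht, calMIndex_div i ht] at h
      have ht1 : (t : ℕ) - 1 = 0 := by
        by_contra hne
        simp [hne] at h
      refine Or.inl ⟨i, 0, (calMIndex_zero i).symm, ?_⟩
      congr 1
      apply Fin.ext
      simp
      omega
  · obtain ⟨i, t, ht, rfl⟩ := exists_calMIndex_eq hp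
    have ht0 : (t : ℕ) ≠ 0 := fun h => ht (Fin.ext h)
    have htlt := t.2
    by_cases hq : q = 0
    · subst hq
      simp only [calM, Matrix.of_apply, if_neg (calMIndex_ne_zero i ht), hk, hk',
        calMIndex_mod i ht, calMIndex_div i ht] at h
      have ht1 : (t : ℕ) - 1 = k := by
        by_contra hne
        simp [hne] at h
      have hlast : t = Fin.last (k + 1) := Fin.ext (by simp; omega)
      refine Or.inl ⟨i, t, rfl, ?_⟩
      rw [hlast, Fin.last_add_one, calMIndex_zero]
    · obtain ⟨l, s, hs, rfl⟩ := exists_calMIndex_eq hq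
      have hs0 : (s : ℕ) ≠ 0 := fun h => hs (Fin.ext h)
      have hslt := s.2
      simp only [calM, Matrix.of_apply, if_neg (calMIndex_ne_zero i ht),
        if_neg (calMIndex_ne_zero l hs), hk,
        calMIndex_mod i ht, calMIndex_div i ht, calMIndex_mod l hs, calMIndex_div l hs] at h
      have hil : i = l := by
        by_contra hne
        simp [Fin.val_inj, hne] at h
      subst hil
      by_cases hts : (t : ℕ) - 1 = s - 1
      · have : t = s := Fin.ext (by omega)
        subst this
        exact Or.inr ⟨rfl, hp⟩
      · have hst : (s : ℕ) - 1 = t - 1 + 1 := by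
          by_contra hne
          simp [hts, hne] at h
        refine Or.inl ⟨i, t, rfl, ?_⟩
        congr 1
        apply Fin.ext
        rw [Fin.val_add_one, if_neg]
        · omega
        · rintro rfl
          simp at hst
          omega

end Entries

/-- The cyclic permutation running through `0` and then through the positions of block `i`. -/
def calMCycle {m k : ℕ} (i : Fin m) : Equiv.Perm (Fin (m * (k + 2 - 1) + 1)) :=
  (finRotate (k + 2)).viaFintypeEmbedding ⟨calMIndex i, calMIndex_injective i⟩

theorem calMCycle_apply_index {m k : ℕ} (i : Fin m) (t : Fin (k + 2)) :
    calMCycle i (calMIndex i t) = calMIndex i (t + 1) := by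
  have := (finRotate (k + 2)).viaFintypeEmbedding_apply_image
    ⟨calMIndex i, calMIndex_injective i⟩ t
  simpa [calMCycle] using this

theorem calMCycle_apply_of_notMem_range {m k : ℕ} (i : Fin m) {p : Fin (m * (k + 2 - 1) + 1)}
    (hp : p ∉ Set.range (calMIndex i)) : calMCycle i p = p :=
  (finRotate (k + 2)).viaFintypeEmbedding_apply_notMem_range
    ⟨calMIndex i, calMIndex_injective i⟩ hp

theorem sign_calMCycle {m k : ℕ} (i : Fin m) :
    Equiv.Perm.sign (calMCycle (k := k) i) = (-1) ^ (k + 1) := by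
  rw [calMCycle, Equiv.Perm.viaFintypeEmbedding_sign, sign_finRotate, show k + 2 - 1 = k + 1 from rfl]

theorem calMCycle_injective {m k : ℕ} :
    Function.Injective (calMCycle : Fin m → Equiv.Perm (Fin (m * (k + 2 - 1) + 1))) := by
  intro i l h
  have h0 := calMCycle_apply_index (k := k) i 0
  rw [h, calMIndex_zero, ← calMIndex_zero l, calMCycle_apply_index] at h0
  exact ((eq_of_calMIndex_eq h0).2 (by simp)).symm

theorem apply_calMIndex_of_le {F : Type*} [Field F] {m k : ℕ} {a : Fin m → Fin (k + 2) → F}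
    {σ : Equiv.Perm (Fin (m * (k + 2 - 1) + 1))}
    (hσ : ∀ p, calM m (k + 2) a p (σ p) ≠ 0) {l : Fin m} {s : Fin (k + 2)}
    (hs : σ (calMIndex l s) = calMIndex l (s + 1)) (t : Fin (k + 2)) (hst : s ≤ t) :
    σ (calMIndex l t) = calMIndex l (t + 1) := by
  induction t using Fin.induction with
  | zero =>
    obtain rfl : s = 0 := le_antisymm hst (Fin.zero_le s)
    exact hs
  | succ j ih =>
    rcases hst.eq_or_lt with rfl | hlt
    · exact hs
    · have hj := ih (Fin.le_castSucc_iff.2 hlt)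
      rw [Fin.coeSucc_eq_succ] at hj
      rcases calM_apply_ne_zero a (hσ (calMIndex l j.succ)) with ⟨i, t, h1, h2⟩ | ⟨h1, -⟩
      · obtain ⟨ht, hi⟩ := eq_of_calMIndex_eq h1
        rw [h2, ← ht, ← hi (Fin.succ_ne_zero j)]
      · have := (eq_of_calMIndex_eq (σ.injective (hj.trans h1))).1
        exact absurd this (Fin.castSucc_lt_succ).ne

theorem eq_calMCycle {F : Type*} [Field F] {m k : ℕ} {a : Fin m → Fin (k + 2) → F}
    {σ : Equiv.Perm (Fin (m * (k + 2 - 1) + 1))}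
    (hσ : ∀ p, calM m (k + 2) a p (σ p) ≠ 0) : ∃ i, calMCycle i = σ := by
  rcases calM_apply_ne_zero a (hσ 0) with ⟨i, t, h1, h2⟩ | ⟨-, h⟩
  swap
  · exact absurd rfl h
  rw [← calMIndex_zero i] at h1
  obtain rfl := (eq_of_calMIndex_eq h1).1
  rw [← calMIndex_zero i] at h2
  have hi := fun t => apply_calMIndex_of_le hσ h2 t (Fin.zero_le t)
  refine ⟨i, Equiv.ext fun p => ?_⟩
  by_cases hp : p ∈ Set.range (calMIndex i)
  · obtain ⟨t, rfl⟩ := hp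
    rw [hi, calMCycle_apply_index]
  · rw [calMCycle_apply_of_notMem_range i hp]
    rcases calM_apply_ne_zero a (hσ p) with ⟨l, s, rfl, h⟩ | ⟨h, -⟩
    · have hl := apply_calMIndex_of_le hσ h (Fin.last _) (Fin.le_last s)
      have hil := hi (Fin.last _)
      rw [Fin.last_add_one, calMIndex_zero] at hl hil
      obtain rfl := (eq_of_calMIndex_eq (σ.injective (hl.trans hil.symm))).2 Fin.last_pos.ne'
      exact absurd ⟨s, rfl⟩ hp
    · exact h

theorem prod_calM_calMCycle {F : Type*} [Field F] {m k : ℕ} (a : Fin m → Fin (k + 2) → F)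
    (i : Fin m) : ∏ p, calM m (k + 2) a p (calMCycle i p) = ∏ j, a i j := by
  rw [← Equiv.prod_comp Fin.revPerm (a i)]
  refine (Fintype.prod_of_injective (calMIndex i) (calMIndex_injective i) _ _ ?_ ?_).symm
  · intro p hp
    rw [calMCycle_apply_of_notMem_range i hp]
    refine calM_apply_self a ?_
    rintro rfl
    exact hp ⟨0, calMIndex_zero i⟩
  · intro t
    rw [calMCycle_apply_index, calM_apply_succ, Fin.revPerm_apply]

/-- Only the cycles through a single block contribute to an immanant-like sum over `𝓜(a)`. -/
theorem sum_perm_mul_prod_calM {F : Type*} [Field F] {m k : ℕ} (a : Fin m → Fin (k + 2) → F)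
    (f : Equiv.Perm (Fin (m * (k + 2 - 1) + 1)) → F) :
    ∑ σ, f σ * ∏ p, calM m (k + 2) a p (σ p) = ∑ i, f (calMCycle i) * ∏ j, a i j := by
  refine (Fintype.sum_of_injective calMCycle calMCycle_injective _ _ ?_ ?_).symm
  · intro σ hσ
    by_contra h
    refine hσ (eq_calMCycle (a := a) fun p => ?_)
    exact Finset.prod_ne_zero_iff.1 (right_ne_zero_of_mul h) p (Finset.mem_univ p)
  · intro i
    rw [prod_calM_calMCycle]

/-- `per 𝓜(a) = ∑_{i=1}^m ∏_{j=1}^n a_{i,j}`, and in particular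
`per 𝓜(a) = (-1)^{n+1} det 𝓜(a)`. -/
theorem permanent_calM {F : Type*} [Field F] (m n : ℕ) (hm : 1 ≤ m) (hn : 2 ≤ n)
    (a : Fin m → Fin n → F) :
    permanent (calM m n a) = ∑ i, ∏ j, a i j ∧
      permanent (calM m n a) = (-1) ^ (n + 1) * (calM m n a).det := by
  obtain ⟨k, rfl⟩ : ∃ k, n = k + 2 := ⟨n - 2, by omega⟩
  have hper : permanent (calM m (k + 2) a) = ∑ i, ∏ j, a i j := by
    simpa [permanent] using sum_perm_mul_prod_calM a fun _ => 1
  have hdet : (calM m (k + 2) a).det = (-1) ^ (k + 1) * ∑ i, ∏ j, a i j := by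
    rw [← Matrix.det_transpose, Matrix.det_apply', Finset.mul_sum]
    simpa [sign_calMCycle] using
      sum_perm_mul_prod_calM a fun σ => ((Equiv.Perm.sign σ : ℤ) : F)
  refine ⟨hper, ?_⟩
  rw [hper, hdet, ← mul_assoc, ← pow_add, Even.neg_one_pow ⟨k + 2, by omega⟩, one_mul]
end
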